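/- arXiv:math/0410040 — 4 statements merged into one kernel-verified Lean document; each statement's English description precedes it below -/
import Mathlib

section
/- The characteristic polynomial of the induced endomorphism ∧²φ of ∧²V, namely ∏_{1≤i<j≤2n} (X − λ_iλ_j), is irreducible over ℚ. In particular the ℚ-subalgebra of End(∧²V) generated by ∧²φ is a field and contains no idempotent other than 0 and 1. -/
open scoped TensorProduct

noncomputable section

namespace VoisinPaper

/-- The splitting field of a polynomial with roots `lam 0, …, lam (m-1)`, realized as the
subfield of `ℂ` generated by the roots. -/
def splittingFieldOfRoots (m : ℕ) (lam : Fin m → ℂ) : IntermediateField ℚ ℂ :=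
  IntermediateField.adjoin ℚ (Set.range lam)

lemma root_mem_splittingFieldOfRoots (m : ℕ) (lam : Fin m → ℂ) (i : Fin m) :
    lam i ∈ splittingFieldOfRoots m lam :=
  IntermediateField.subset_adjoin ℚ _ ⟨i, rfl⟩

/-- Condition (*): the Galois group of the splitting field of the roots over `ℚ` acts on the
set of roots as the full symmetric group on `m` letters. -/
def galoisActsFully (m : ℕ) (lam : Fin m → ℂ) : Prop :=
  ∀ τ : Equiv.Perm (Fin m),
    ∃ σ : (splittingFieldOfRoots m lam) ≃ₐ[ℚ] (splittingFieldOfRoots m lam),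
      ∀ i, (σ ⟨lam i, root_mem_splittingFieldOfRoots m lam i⟩ : ℂ) = lam (τ i)

lemma map_mem_exteriorPower (V : Type) [AddCommGroup V] [Module ℚ V] (φ : V →ₗ[ℚ] V) (k : ℕ) :
    ∀ x ∈ ⋀[ℚ]^k V, ExteriorAlgebra.map φ x ∈ ⋀[ℚ]^k V := by
  intro x hx
  suffices h : ∀ m : ℕ, Submodule.map (ExteriorAlgebra.map φ).toLinearMap
      ((LinearMap.range (ExteriorAlgebra.ι ℚ (M := V))) ^ m) ≤
      (LinearMap.range (ExteriorAlgebra.ι ℚ (M := V))) ^ m by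
    exact h k ⟨x, hx, rfl⟩
  have h1 : Submodule.map (ExteriorAlgebra.map φ).toLinearMap
      (LinearMap.range (ExteriorAlgebra.ι ℚ (M := V))) ≤
      LinearMap.range (ExteriorAlgebra.ι ℚ (M := V)) := by
    rw [ExteriorAlgebra.ι_range_map_map]
    exact LinearMap.map_le_range
  intro m
  induction m with
  | zero => exact le_of_eq (Submodule.map_one _)
  | succ m ih =>
    rw [pow_succ, Submodule.map_mul]
    exact mul_le_mul' ih h1

/-- The endomorphism `⋀^k φ` of the `k`-th exterior power induced by `φ`. -/
def extPowMap (V : Type) [AddCommGroup V] [Module ℚ V] (φ : V →ₗ[ℚ] V) (k : ℕ) :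
    ↥(⋀[ℚ]^k V) →ₗ[ℚ] ↥(⋀[ℚ]^k V) :=
  (ExteriorAlgebra.map φ).toLinearMap.restrict (map_mem_exteriorPower V φ k)

section Compound

open Module Set Set.powersetCard

lemma toMatrix_extMap {R M I : Type*} [CommRing R] [AddCommGroup M] [Module R M]
    [LinearOrder I] [Fintype I] (k : ℕ) (b : Basis I R M) (f : M →ₗ[R] M)
    (s t : powersetCard I k) :
    LinearMap.toMatrix (b.exteriorPower k) (b.exteriorPower k) (exteriorPower.map k f) s t =
      (Matrix.of fun i j => LinearMap.toMatrix b b f (powersetCard.ofFinEmbEquiv.symm s j)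
        (powersetCard.ofFinEmbEquiv.symm t i)).det := by
  rw [LinearMap.toMatrix_apply, exteriorPower.basis_apply, exteriorPower.basis_repr_apply,
    exteriorPower.map_apply_ιMulti_family, exteriorPower.ιMulti_family,
    exteriorPower.ιMultiDual_apply_ιMulti]
  congr 1
  ext i j
  simp [LinearMap.toMatrix_apply]

lemma charpoly_extMap_map {R S M I : Type*} [CommRing R] [CommRing S] [Algebra R S]
    [AddCommGroup M] [Module R M] [Module.Finite R M] [Module.Free R M]
    [LinearOrder I] [Fintype I] (k : ℕ) (b : Basis I R M) (f : M →ₗ[R] M) :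
    (LinearMap.charpoly (exteriorPower.map k f)).map (algebraMap R S) =
      LinearMap.charpoly (exteriorPower.map k
        (Matrix.toLin' ((LinearMap.toMatrix b b f).map (algebraMap R S)))) := by
  classical
  rw [← LinearMap.charpoly_toMatrix _ (b.exteriorPower k),
    ← LinearMap.charpoly_toMatrix _ ((Pi.basisFun S I).exteriorPower k),
    ← Matrix.charpoly_map]
  congr 1
  ext s t
  rw [toMatrix_extMap, Matrix.map_apply, toMatrix_extMap, RingHom.map_det]
  congr 1
  ext i j
  simp [LinearMap.toMatrix_apply]

lemma charpoly_extMap_eigen {K M I : Type*} [Field K]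
    [AddCommGroup M] [Module K M] [Module.Finite K M]
    [LinearOrder I] [Fintype I] (k : ℕ) (b : Basis I K M) (f : M →ₗ[K] M) (lam : I → K)
    (h : ∀ i, f (b i) = lam i • b i) :
    LinearMap.charpoly (exteriorPower.map k f) =
      ∏ s ∈ Finset.powersetCard k (Finset.univ : Finset I),
          (Polynomial.X - Polynomial.C (∏ i ∈ s, lam i)) := by
  classical
  rw [← LinearMap.charpoly_toMatrix _ (b.exteriorPower k)]
  have : LinearMap.toMatrix (b.exteriorPower k) (b.exteriorPower k) (exteriorPower.map k f) =
      Matrix.diagonal (fun s : powersetCard I k => ∏ i ∈ s.1, lam i) := by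
    ext s t
    have h1 : exteriorPower.map k f (b.exteriorPower k t) =
        (∏ i ∈ t.1, lam i) • b.exteriorPower k t := by
      rw [exteriorPower.basis_apply, exteriorPower.map_apply_ιMulti_family,
        exteriorPower.ιMulti_family, exteriorPower.ιMulti_family]
      have h2 : (⇑f ∘ ⇑b) ∘ ⇑(powersetCard.ofFinEmbEquiv.symm t) =
          fun i => lam (powersetCard.ofFinEmbEquiv.symm t i) •
            (b ∘ ⇑(powersetCard.ofFinEmbEquiv.symm t)) i := by
        ext i
        simp [h]
      rw [h2, AlternatingMap.map_smul_univ]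
      congr 1
      have h3 : t.1 = Finset.univ.map (powersetCard.ofFinEmbEquiv.symm t).toEmbedding := by
        ext i
        have := mem_range_ofFinEmbEquiv_symm_iff_mem t i
        simp only [Set.mem_range] at this
        simp [this]
        rfl
      conv_rhs => rw [h3]
      simp
    rw [LinearMap.toMatrix_apply, h1]
    simp [Matrix.diagonal_apply, Finsupp.single_apply, -exteriorPower.coe_basis, eq_comm]
    split_ifs with hst
    · rw [hst]
    · rfl
  rw [this, Matrix.charpoly_diagonal]
  symm
  refine Finset.prod_subtype _ (fun s => ?_)
    (fun s : Finset I => Polynomial.X - Polynomial.C (∏ i ∈ s, lam i))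
  simp [Finset.mem_powersetCard, Set.powersetCard]

end Compound

lemma extPowMap_eq (V : Type) [AddCommGroup V] [Module ℚ V] (φ : V →ₗ[ℚ] V) (k : ℕ) :
    extPowMap V φ k = exteriorPower.map k φ := by
  apply exteriorPower.linearMap_ext
  ext v
  simp only [LinearMap.compAlternatingMap_apply, exteriorPower.map_apply_ιMulti]
  exact ExteriorAlgebra.map_apply_ιMulti φ v

lemma charpoly_extPow_formula
    (m : ℕ) (V : Type) [AddCommGroup V] [Module ℚ V] [FiniteDimensional ℚ V]
    (hdim : Module.finrank ℚ V = m) (k : ℕ)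
    (φ : V →ₗ[ℚ] V)
    (lam : Fin m → ℂ) (hinj : Function.Injective lam)
    (hroot : ∀ i, Polynomial.aeval (lam i) (LinearMap.charpoly φ) = 0) :
    (LinearMap.charpoly (extPowMap V φ k)).map (algebraMap ℚ ℂ) =
        ∏ s ∈ Finset.powersetCard k (Finset.univ : Finset (Fin m)),
          (Polynomial.X - Polynomial.C (∏ i ∈ s, lam i)) := by
  classical
  let b : Module.Basis (Fin m) ℚ V := Module.finBasisOfFinrankEq ℚ V hdim
  rw [extPowMap_eq, charpoly_extMap_map k b]
  set g : Module.End ℂ (Fin m → ℂ) :=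
    Matrix.toLin' ((LinearMap.toMatrix b b φ).map (algebraMap ℚ ℂ)) with hg
  have hev : ∀ i, g.HasEigenvalue (lam i) := by
    intro i
    rw [Module.End.hasEigenvalue_iff_isRoot_charpoly, hg, Matrix.charpoly_toLin',
      Matrix.charpoly_map, LinearMap.charpoly_toMatrix, Polynomial.IsRoot,
      Polynomial.eval_map_algebraMap]
    exact hroot i
  choose v hv using fun i => (hev i).exists_hasEigenvector
  have hli : LinearIndependent ℂ v := Module.End.eigenvectors_linearIndependent' g lam hinj v hv
  let c : Module.Basis (Fin m) ℂ (Fin m → ℂ) :=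
    basisOfLinearIndependentOfCardEqFinrank' v hli (by simp)
  refine charpoly_extMap_eigen k c g lam (fun i => ?_)
  simpa [c] using (hv i).apply_eq_smul

lemma gal_transfer (m : ℕ) (lam : Fin m → ℂ) (hgal : galoisActsFully m lam)
    (τ : Equiv.Perm (Fin m)) :
    ∃ (f : splittingFieldOfRoots m lam →ₐ[ℚ] ℂ) (x : Fin m → splittingFieldOfRoots m lam),
      (∀ i, (splittingFieldOfRoots m lam).val (x i) = lam i) ∧ ∀ i, f (x i) = lam (τ i) := by
  obtain ⟨σ, hσ⟩ := hgal τ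
  exact ⟨(splittingFieldOfRoots m lam).val.comp σ.toAlgHom,
    fun i => ⟨lam i, root_mem_splittingFieldOfRoots m lam i⟩, fun i => rfl, fun i => hσ i⟩

lemma gal_prod_eq (m : ℕ) (lam : Fin m → ℂ) (hgal : galoisActsFully m lam)
    (τ : Equiv.Perm (Fin m)) (s t : Finset (Fin m))
    (h : ∏ i ∈ s, lam i = ∏ i ∈ t, lam i) : ∏ i ∈ s, lam (τ i) = ∏ i ∈ t, lam (τ i) := by
  obtain ⟨f, x, h1, h2⟩ := gal_transfer m lam hgal τ
  simp only [← h1, ← map_prod] at h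
  simp only [← h2, ← map_prod]
  rw [(splittingFieldOfRoots m lam).val.toRingHom.injective h]

lemma gal_aeval (m : ℕ) (lam : Fin m → ℂ) (hgal : galoisActsFully m lam)
    (τ : Equiv.Perm (Fin m)) (s : Finset (Fin m)) (p : Polynomial ℚ)
    (h : Polynomial.aeval (∏ i ∈ s, lam i) p = 0) :
    Polynomial.aeval (∏ i ∈ s, lam (τ i)) p = 0 := by
  obtain ⟨f, x, h1, h2⟩ := gal_transfer m lam hgal τ
  simp only [← h1, ← map_prod] at h
  simp only [← h2, ← map_prod]
  rw [Polynomial.aeval_algHom_apply] at h ⊢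
  have h0 : Polynomial.aeval (∏ i ∈ s, x i) p = 0 :=
    (splittingFieldOfRoots m lam).val.toRingHom.injective (h.trans (map_zero _).symm)
  rw [h0, map_zero]

lemma lam_ne_zero (m : ℕ) (hm : 2 ≤ m) (lam : Fin m → ℂ) (hinj : Function.Injective lam)
    (hgal : galoisActsFully m lam) (i : Fin m) : lam i ≠ 0 := by
  intro h0
  have : Nontrivial (Fin m) := Fin.nontrivial_iff_two_le.mpr hm
  obtain ⟨j, hj⟩ := exists_ne i
  obtain ⟨f, x, h1, h2⟩ := gal_transfer m lam hgal (Equiv.swap i j)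
  have hx : x i = 0 := (splittingFieldOfRoots m lam).val.toRingHom.injective
    (((h1 i).trans h0).trans (map_zero _).symm)
  have h3 := h2 i
  rw [hx, map_zero, Equiv.swap_apply_left] at h3
  exact hj (hinj (h3.symm.trans h0.symm))

lemma prod_injOn (m : ℕ) (k : ℕ) (hm : 2 * k < m) (hm2 : 2 ≤ m) (lam : Fin m → ℂ)
    (hinj : Function.Injective lam)
    (hgal : galoisActsFully m lam) (s t : Finset (Fin m)) (hs : s.card = k) (ht : t.card = k)
    (h : ∏ i ∈ s, lam i = ∏ i ∈ t, lam i) : s = t := by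
  classical
  by_contra hne
  have hsub : ¬ s ⊆ t := fun hst => hne (Finset.eq_of_subset_of_card_le hst (by omega))
  obtain ⟨a, has, hat⟩ := Finset.not_subset.mp hsub
  obtain ⟨c, hc⟩ : ∃ c, c ∉ s ∪ t := by
    by_contra! hall
    have h1 : s ∪ t = Finset.univ := Finset.eq_univ_iff_forall.mpr hall
    have h2 := Finset.card_union_le s t
    rw [h1, Finset.card_univ, Fintype.card_fin] at h2
    omega
  simp only [Finset.mem_union, not_or] at hc
  have h' := gal_prod_eq m lam hgal (Equiv.swap a c) s t h
  have ht' : ∏ i ∈ t, lam (Equiv.swap a c i) = ∏ i ∈ t, lam i := by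
    refine Finset.prod_congr rfl fun i hi => ?_
    rw [Equiv.swap_apply_of_ne_of_ne]
    · rintro rfl; exact hat hi
    · rintro rfl; exact hc.2 hi
  rw [ht', ← h, ← Finset.mul_prod_erase s _ has, ← Finset.mul_prod_erase s lam has] at h'
  have he : ∏ i ∈ s.erase a, lam (Equiv.swap a c i) = ∏ i ∈ s.erase a, lam i := by
    refine Finset.prod_congr rfl fun i hi => ?_
    rw [Equiv.swap_apply_of_ne_of_ne]
    · exact Finset.ne_of_mem_erase hi
    · rintro rfl; exact hc.1 (Finset.mem_of_mem_erase hi)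
  rw [he, Equiv.swap_apply_left] at h'
  have hca := hinj (mul_right_cancel₀
    (Finset.prod_ne_zero_iff.mpr fun i _ => lam_ne_zero m hm2 lam hinj hgal i) h')
  exact hc.1 (hca ▸ has)

lemma exists_perm_prod (m : ℕ) (lam : Fin m → ℂ) (s t : Finset (Fin m))
    (h : s.card = t.card) :
    ∃ τ : Equiv.Perm (Fin m), ∏ i ∈ s, lam (τ i) = ∏ i ∈ t, lam i := by
  classical
  let e : {x // x ∈ s} ≃ {x // x ∈ t} := Finset.equivOfCardEq h
  refine ⟨e.extendSubtype, ?_⟩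
  refine Finset.prod_bij (fun i _ => e.extendSubtype i)
    (fun i hi => e.extendSubtype_mem i hi) (fun i _ j _ hij => e.extendSubtype.injective hij)
    (fun j hj => ?_) (fun _ _ => rfl)
  refine ⟨(e.symm ⟨j, hj⟩).1, (e.symm ⟨j, hj⟩).2, ?_⟩
  rw [e.extendSubtype_apply_of_mem _ (e.symm ⟨j, hj⟩).2]
  simp

lemma irreducible_of_prod (m : ℕ) (k : ℕ) (hm : 2 * k < m) (hm2 : 2 ≤ m) (lam : Fin m → ℂ)
    (hinj : Function.Injective lam) (hgal : galoisActsFully m lam) (P : Polynomial ℚ)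
    (hP : P.Monic)
    (h : P.map (algebraMap ℚ ℂ) =
        ∏ s ∈ Finset.powersetCard k (Finset.univ : Finset (Fin m)),
          (Polynomial.X - Polynomial.C (∏ i ∈ s, lam i))) : Irreducible P := by
  classical
  obtain ⟨s₀, -, hs₀⟩ := Finset.exists_subset_card_eq
    (show k ≤ (Finset.univ : Finset (Fin m)).card by simp; omega)
  have hroot : Polynomial.aeval (∏ i ∈ s₀, lam i) P = 0 := by
    rw [← Polynomial.eval_map_algebraMap, h, Polynomial.eval_prod]
    exact Finset.prod_eq_zero (i := s₀) (by simp [Finset.mem_powersetCard, hs₀])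
      (by rw [Polynomial.eval_sub, Polynomial.eval_X, Polynomial.eval_C, sub_self])
  have hint : IsIntegral ℚ (∏ i ∈ s₀, lam i) := ⟨P, hP, by simpa [Polynomial.aeval_def] using hroot⟩
  have hirr := minpoly.irreducible hint
  have hdvd : P ∣ minpoly ℚ (∏ i ∈ s₀, lam i) := by
    rw [← Polynomial.map_dvd_map' (algebraMap ℚ ℂ), h]
    refine Finset.prod_dvd_of_coprime ?_ ?_
    · intro s hs t ht hst
      simp only [Finset.mem_coe,
        Finset.mem_powersetCard] at hs ht
      refine Polynomial.isCoprime_X_sub_C_of_isUnit_sub (IsUnit.mk0 _ (sub_ne_zero.mpr ?_))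
      intro heq
      exact hst (prod_injOn m k hm hm2 lam hinj hgal s t hs.2 ht.2 heq)
    · intro s hs
      rw [Finset.mem_powersetCard] at hs
      rw [Polynomial.dvd_iff_isRoot, Polynomial.IsRoot, Polynomial.eval_map_algebraMap]
      obtain ⟨τ, hτ⟩ := exists_perm_prod m lam s₀ s (hs₀.trans hs.2.symm)
      rw [← hτ]
      exact gal_aeval m lam hgal τ s₀ _ (minpoly.aeval _ _)
  have hassoc : Associated P (minpoly ℚ (∏ i ∈ s₀, lam i)) :=
    associated_of_dvd_dvd hdvd (minpoly.dvd _ _ hroot)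
  exact hassoc.symm.irreducible hirr

lemma isField_adjoin {W : Type*} [AddCommGroup W] [Module ℚ W] [FiniteDimensional ℚ W]
    (g : Module.End ℚ W) (h : Irreducible (LinearMap.charpoly g)) :
    IsField (Algebra.adjoin ℚ ({g} : Set (Module.End ℚ W))) := by
  have hnt : Nontrivial W := by
    by_contra hn
    rw [not_nontrivial_iff_subsingleton] at hn
    have h1 := LinearMap.charpoly_natDegree g
    rw [Module.finrank_zero_of_subsingleton] at h1
    exact (h.natDegree_pos).ne' h1
  refine ⟨⟨0, 1, zero_ne_one⟩, ?_, ?_⟩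
  · rintro ⟨x, hx⟩ ⟨y, hy⟩
    rw [Algebra.adjoin_singleton_eq_range_aeval] at hx hy
    obtain ⟨p, rfl⟩ := hx
    obtain ⟨q, rfl⟩ := hy
    apply Subtype.ext
    change Polynomial.aeval g p * Polynomial.aeval g q =
      Polynomial.aeval g q * Polynomial.aeval g p
    rw [← map_mul, ← map_mul, mul_comm]
  · rintro ⟨x, hx⟩ hx0
    have hx' := hx
    rw [Algebra.adjoin_singleton_eq_range_aeval] at hx'
    obtain ⟨p, hp⟩ := hx'
    replace hp : Polynomial.aeval g p = x := hp
    have hndvd : ¬ LinearMap.charpoly g ∣ p := by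
      rintro ⟨q, rfl⟩
      apply hx0
      apply Subtype.ext
      change x = 0
      rw [← hp, map_mul, LinearMap.aeval_self_charpoly, zero_mul]
    obtain ⟨a, c, hac⟩ := (h.coprime_iff_not_dvd).mpr hndvd
    refine ⟨⟨Polynomial.aeval g c, Polynomial.aeval_mem_adjoin_singleton ℚ g⟩, ?_⟩
    apply Subtype.ext
    change x * Polynomial.aeval g c = 1
    have h2 := congrArg (Polynomial.aeval g) hac
    rw [map_add, map_mul, map_mul, LinearMap.aeval_self_charpoly, mul_zero, zero_add,
      map_one] at h2
    rw [← hp, ← map_mul, mul_comm, map_mul, h2]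

/-- Under condition (*), the characteristic polynomial of `⋀²φ` acting on
`⋀²V`, namely `∏_{1 ≤ i < j ≤ 2n} (X - λᵢλⱼ)`, is irreducible over `ℚ`; in particular the
`ℚ`-subalgebra of `End(⋀²V)` generated by `⋀²φ` is a field and contains no idempotent other
than `0` and `1`. -/
theorem charpoly_extPow_two_irreducible
    (n : ℕ) (hn : 4 ≤ n)
    (V : Type) [AddCommGroup V] [Module ℚ V] [FiniteDimensional ℚ V]
    [FiniteDimensional ℚ ↥(⋀[ℚ]^2 V)]
    (hdim : Module.finrank ℚ V = 2 * n)
    (φ : V →ₗ[ℚ] V)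
    (lam : Fin (2 * n) → ℂ) (hinj : Function.Injective lam)
    (hroot : ∀ i, Polynomial.aeval (lam i) (LinearMap.charpoly φ) = 0)
    (hgal : galoisActsFully (2 * n) lam) :
    (LinearMap.charpoly (extPowMap V φ 2)).map (algebraMap ℚ ℂ) =
        ∏ s ∈ Finset.powersetCard 2 (Finset.univ : Finset (Fin (2 * n))),
          (Polynomial.X - Polynomial.C (∏ i ∈ s, lam i)) ∧
      Irreducible (LinearMap.charpoly (extPowMap V φ 2)) ∧
      IsField (Algebra.adjoin ℚ ({extPowMap V φ 2} : Set (Module.End ℚ ↥(⋀[ℚ]^2 V)))) ∧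
      (∀ u : Module.End ℚ ↥(⋀[ℚ]^2 V),
        u ∈ Algebra.adjoin ℚ ({extPowMap V φ 2} : Set (Module.End ℚ ↥(⋀[ℚ]^2 V))) →
        u * u = u → u = 0 ∨ u = 1) := by
  have h1 := charpoly_extPow_formula (2 * n) V hdim 2 φ lam hinj hroot
  have h2 : Irreducible (LinearMap.charpoly (extPowMap V φ 2)) :=
    irreducible_of_prod (2 * n) 2 (by omega) (by omega) lam hinj hgal _
      (LinearMap.charpoly_monic _) h1
  have h3 := isField_adjoin (extPowMap V φ 2) h2
  refine ⟨h1, h2, h3, ?_⟩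
  intro u hu huu
  by_cases h0 : u = 0
  · exact Or.inl h0
  · right
    obtain ⟨w, hw⟩ := h3.mul_inv_cancel (a := ⟨u, hu⟩) (fun h => h0 (congrArg Subtype.val h))
    have hw' : u * w.1 = 1 := congrArg Subtype.val hw
    calc u = u * (u * w.1) := by rw [hw', mul_one]
      _ = 1 := by rw [← mul_assoc, huu, hw']

end VoisinPaper
end
end

section
/- Every endomorphism of the Hodge structure on ∧²V is a polynomial in ∧²φ: the set of ℚ-linear maps ψ : ∧²V → ∧²V whose complexification maps each of the (2,0)-, (1,1)- and (0,2)-components of ∧²V_ℂ into itself is exactly the ℚ-subalgebra of End(∧²V) generated by ∧²φ. (This is the paper's claim that the algebra End H²(T,ℚ) of Hodge endomorphisms is generated by φ_T^*.) -/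
open scoped TensorProduct

noncomputable section

namespace VoisinPaper

/-- The canonical map `V → ℂ ⊗_ℚ V`, `v ↦ 1 ⊗ v`. -/
def iotaV (V : Type) [AddCommGroup V] [Module ℚ V] : V →ₗ[ℚ] ℂ ⊗[ℚ] V :=
  TensorProduct.mk ℚ ℂ V 1

/-- The conjugation of `ℂ ⊗_ℚ V`: the `ℂ`-antilinear involution fixing `1 ⊗ V`. -/
def conjV (V : Type) [AddCommGroup V] [Module ℚ V] : ℂ ⊗[ℚ] V →ₗ[ℚ] ℂ ⊗[ℚ] V :=
  TensorProduct.map ((Complex.conjAe.toLinearMap).restrictScalars ℚ) LinearMap.id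

/-- The image `c(W)` of a subspace `W ⊆ ℂ ⊗_ℚ V` under the conjugation. -/
def conjSub (V : Type) [AddCommGroup V] [Module ℚ V] (W : Submodule ℂ (ℂ ⊗[ℚ] V)) :
    Submodule ℚ (ℂ ⊗[ℚ] V) :=
  Submodule.map (conjV V) (W.restrictScalars ℚ)

/-- The `(p, k-p)` Hodge component of `⋀^k (ℂ ⊗ V)` (sitting inside the exterior algebra of
`ℂ ⊗ V`): the `ℂ`-span of wedge products of `p` elements of `W` and `k - p` elements of
`c(W)`; this is the image of `⋀^p W ⊗ ⋀^{k-p} c(W)` under the wedge product. -/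
def hodgeComp (V : Type) [AddCommGroup V] [Module ℚ V] (W : Submodule ℂ (ℂ ⊗[ℚ] V))
    (k p : ℕ) : Submodule ℂ (ExteriorAlgebra ℂ (ℂ ⊗[ℚ] V)) :=
  Submodule.span ℂ {x | ∃ v : Fin k → ℂ ⊗[ℚ] V,
     (∀ i : Fin k, ((i : ℕ) < p → v i ∈ W) ∧ (p ≤ (i : ℕ) → v i ∈ conjSub V W)) ∧
     x = ExteriorAlgebra.ιMulti ℂ k v}

/-- The natural "complexification" morphism from the exterior algebra of `V` over `ℚ` to the
exterior algebra of `ℂ ⊗ V` over `ℂ`; it identifies `⋀^k_ℚ V` with the rational points of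
`⋀^k_ℂ (ℂ ⊗ V)`. -/
def thetaA (V : Type) [AddCommGroup V] [Module ℚ V]
    [Algebra ℚ (ExteriorAlgebra ℂ (ℂ ⊗[ℚ] V))]
    [IsScalarTower ℚ ℂ (ExteriorAlgebra ℂ (ℂ ⊗[ℚ] V))] :
    ExteriorAlgebra ℚ V →ₐ[ℚ] ExteriorAlgebra ℂ (ℂ ⊗[ℚ] V) :=
  ExteriorAlgebra.lift ℚ
    ⟨((ExteriorAlgebra.ι ℂ (M := ℂ ⊗[ℚ] V)).restrictScalars ℚ) ∘ₗ iotaV V,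
      fun _ => ExteriorAlgebra.ι_sq_zero _⟩

section helpers
open Module Polynomial

/-- Descent: a rational matrix that is a complex polynomial in a rational matrix lies in
the rational algebra generated by it. -/
lemma mem_adjoin_of_aeval {J : Type*} [Fintype J] [DecidableEq J] (MT Mp : Matrix J J ℚ)
    (p : ℂ[X]) (h : (algebraMap ℚ ℂ).mapMatrix Mp = aeval ((algebraMap ℚ ℂ).mapMatrix MT) p) :
    Mp ∈ Algebra.adjoin ℚ ({MT} : Set (Matrix J J ℚ)) := by
  by_contra hn
  obtain ⟨f, hf1, hf2⟩ := Submodule.exists_le_ker_of_notMem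
    (p := Subalgebra.toSubmodule (Algebra.adjoin ℚ ({MT} : Set (Matrix J J ℚ)))) hn
  let F : Matrix J J ℂ →ₗ[ℂ] ℂ :=
    ∑ i, ∑ j, ((f (Matrix.single i j 1) : ℚ) : ℂ) • Matrix.entryLinearMap ℂ ℂ i j
  have hF : ∀ M : Matrix J J ℚ, F ((algebraMap ℚ ℂ).mapMatrix M) = ((f M : ℚ) : ℂ) := by
    intro M
    conv_rhs => rw [Matrix.matrix_eq_sum_single M]
    simp only [F, LinearMap.sum_apply, LinearMap.smul_apply, map_sum, Rat.cast_sum]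
    refine Finset.sum_congr rfl fun i _ => Finset.sum_congr rfl fun j _ => ?_
    have : Matrix.single i j (M i j) = (M i j) • Matrix.single i j (1 : ℚ) := by simp
    rw [this, map_smul]
    simp [mul_comm]
  have h2 := congrArg F h
  rw [hF, aeval_eq_sum_range, map_sum, Finset.sum_eq_zero] at h2
  · exact hf1 (by exact_mod_cast h2)
  · intro k _
    rw [map_smul, ← map_pow, hF]
    have : f (MT ^ k) = 0 := hf2 (Subalgebra.pow_mem _ (Algebra.self_mem_adjoin_singleton ℚ MT) k)
    simp [this]

lemma aeval_basis {X J : Type*} [AddCommGroup X] [Module ℂ X] (T : End ℂ X)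
    (u : J → X) (μ : J → ℂ) (hu : ∀ A, T (u A) = μ A • u A) (p : ℂ[X]) (A : J) :
    aeval T p (u A) = p.eval (μ A) • u A := by
  by_cases h : u A = 0
  · simp [h]
  · exact Module.End.aeval_apply_of_hasEigenvector
      (⟨Module.End.mem_eigenspace_iff.2 (hu A), h⟩ : End.HasEigenvector T (μ A) (u A))

/-- spectral polynomial -/
noncomputable def specPoly {J F : Type*} [Fintype J] [DecidableEq J] [Field F] (μ : J → F) (A : J) : F[X] :=
  ∏ B ∈ Finset.univ.erase A, (X - C (μ B))

lemma specPoly_eval_ne {J F : Type*} [Fintype J] [DecidableEq J] [Field F] (μ : J → F)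
    {A B : J} (h : B ≠ A) : (specPoly μ A).eval (μ B) = 0 := by
  rw [specPoly, eval_prod]
  exact Finset.prod_eq_zero (Finset.mem_erase.2 ⟨h, Finset.mem_univ B⟩) (by simp)

lemma specPoly_eval_self {J F : Type*} [Fintype J] [DecidableEq J] [Field F] (μ : J → F)
    (hμ : Function.Injective μ) (A : J) : (specPoly μ A).eval (μ A) ≠ 0 := by
  rw [specPoly, eval_prod, Finset.prod_ne_zero_iff]
  intro B hB
  simp only [eval_sub, eval_X, eval_C, ne_eq, sub_eq_zero]
  intro h
  exact (Finset.mem_erase.1 hB).1 (hμ h).symm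

lemma specPoly_map {J F G : Type*} [Fintype J] [DecidableEq J] [Field F] [Field G] (f : F →+* G)
    (μ : J → F) (ν : J → G) (π : Equiv.Perm J) (h : ∀ C, f (μ C) = ν (π C)) (A : J) :
    (specPoly μ A).map f = specPoly ν (π A) := by
  rw [specPoly, specPoly, Polynomial.map_prod]
  refine Finset.prod_bij (fun B _ => π B) ?_ ?_ ?_ ?_
  · intro B hB; simpa using hB
  · intro B _ B' _ hh; exact π.injective hh
  · intro B hB
    refine ⟨π.symm B, ?_, by simp⟩
    simp only [Finset.mem_erase, Finset.mem_univ, and_true] at hB ⊢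
    intro hh; exact hB (by rw [← hh]; simp)
  · intro B _; simp [h]

lemma map_aeval_matrix {J F G : Type*} [Fintype J] [DecidableEq J] [Field F] [Field G] (f : F →+* G)
    (M : Matrix J J F) (p : F[X]) :
    f.mapMatrix (aeval M p) = aeval (f.mapMatrix M) (p.map f) := by
  rw [aeval_def, aeval_def, hom_eval₂, eval₂_map]
  congr 1
  ext x i j
  simp only [RingHom.comp_apply, RingHom.mapMatrix_apply, Matrix.map_apply,
    Matrix.algebraMap_matrix_apply, apply_ite f, map_zero]
  rfl

lemma core {J : Type*} [Fintype J] [DecidableEq J] {X : Type*} [AddCommGroup X] [Module ℂ X]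
    (K : IntermediateField ℚ ℂ) (MT Mp : Matrix J J ℚ) (g u : Basis J ℂ X)
    (T P : End ℂ X) (hT : T = Matrix.toLinAlgEquiv g ((algebraMap ℚ ℂ).mapMatrix MT))
    (hP : P = Matrix.toLinAlgEquiv g ((algebraMap ℚ ℂ).mapMatrix Mp))
    (μ : J → K) (hμ : Function.Injective μ) (hu : ∀ A, T (u A) = (μ A : ℂ) • u A)
    (h : ∀ A B, A ≠ B → ∃ (σ : K ≃ₐ[ℚ] K) (π : Equiv.Perm J), (∀ C, σ (μ C) = μ (π C)) ∧
      u.repr (P (u (π B))) (π A) = 0) :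
    Mp ∈ Algebra.adjoin ℚ ({MT} : Set (Matrix J J ℚ)) := by
  let ν : J → ℂ := fun A => (μ A : ℂ)
  have hν : Function.Injective ν := fun a b hab => hμ (Subtype.ext hab)
  let MTK : Matrix J J K := (algebraMap ℚ K).mapMatrix MT
  let MpK : Matrix J J K := (algebraMap ℚ K).mapMatrix Mp
  let Q : J → J → Matrix J J K := fun A B =>
    aeval MTK (specPoly μ A) * MpK * aeval MTK (specPoly μ B)
  have compm : ∀ (F G : Type) [Field F] [Field G] [Algebra ℚ F] [Algebra ℚ G] (f : F →+* G)
      (M : Matrix J J ℚ), f.mapMatrix ((algebraMap ℚ F).mapMatrix M) =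
        (algebraMap ℚ G).mapMatrix M := by
    intro F G _ _ _ _ f M
    ext i j
    simp
  have hQσ : ∀ (σ : K ≃ₐ[ℚ] K) (π : Equiv.Perm J), (∀ C, σ (μ C) = μ (π C)) → ∀ A B,
      (σ : K →+* K).mapMatrix (Q A B) = Q (π A) (π B) := by
    intro σ π hσ A B
    simp only [Q, map_mul, map_aeval_matrix, MTK, MpK, compm]
    rw [specPoly_map (σ : K →+* K) μ μ π hσ, specPoly_map (σ : K →+* K) μ μ π hσ]
  have hQC : ∀ A B, Matrix.toLinAlgEquiv g ((algebraMap K ℂ).mapMatrix (Q A B)) =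
      aeval T (specPoly ν A) * P * aeval T (specPoly ν B) := by
    intro A B
    simp only [Q, map_mul, map_aeval_matrix, MTK, MpK, compm]
    rw [specPoly_map (algebraMap K ℂ) μ ν 1 (fun _ => rfl),
      specPoly_map (algebraMap K ℂ) μ ν 1 (fun _ => rfl), hT, hP]
    have key : ∀ p : ℂ[X], (Matrix.toLinAlgEquiv g) (aeval ((algebraMap ℚ ℂ).mapMatrix MT) p) =
        aeval (Matrix.toLinAlgEquiv g ((algebraMap ℚ ℂ).mapMatrix MT)) p := fun p =>
      (Polynomial.aeval_algHom_apply (Matrix.toLinAlgEquiv g).toAlgHom _ _).symm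
    rw [key, key]
    rfl
  have hproj : ∀ A x, aeval T (specPoly ν A) x =
      ((specPoly ν A).eval (ν A) * u.repr x A) • u A := by
    intro A x
    conv_lhs => rw [← u.sum_repr x]
    rw [map_sum, Finset.sum_eq_single A]
    · rw [map_smul, aeval_basis T u ν hu, smul_smul, mul_comm]
    · intro B _ hB
      rw [map_smul, aeval_basis T u ν hu, specPoly_eval_ne ν hB]; simp
    · simp
  have hQ0 : ∀ A B, Q A B = 0 ↔ u.repr (P (u B)) A = 0 := by
    intro A B
    have h1 : Q A B = 0 ↔ aeval T (specPoly ν A) * P * aeval T (specPoly ν B) = 0 := by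
      rw [← hQC, EmbeddingLike.map_eq_zero_iff]
      constructor
      · intro hh; rw [hh, map_zero]
      · intro hh
        ext i j
        have := congrFun (congrFun hh i) j
        simpa using this
    rw [h1]
    constructor
    · intro hh
      have := LinearMap.congr_fun hh (u B)
      simp only [Module.End.mul_apply, hproj, map_smul, LinearMap.zero_apply] at this
      have hA := specPoly_eval_self ν hν A
      have hB := specPoly_eval_self ν hν B
      have hne := u.ne_zero A
      simpa [hA, hB, hne] using this
    · intro hh
      ext x
      simp [Module.End.mul_apply, hproj, hh]
  have hdiag : ∀ A B, A ≠ B → u.repr (P (u B)) A = 0 := by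
    intro A B hAB
    obtain ⟨σ, π, hσ, h0⟩ := h A B hAB
    rw [← hQ0] at h0 ⊢
    rw [← hQσ σ π hσ] at h0
    ext i j
    have := congrFun (congrFun h0 i) j
    simpa using this
  apply mem_adjoin_of_aeval MT Mp (Lagrange.interpolate Finset.univ ν (fun A => u.repr (P (u A)) A))
  apply (Matrix.toLinAlgEquiv g).injective
  rw [← hP]
  have : (Matrix.toLinAlgEquiv g) (aeval ((algebraMap ℚ ℂ).mapMatrix MT)
      (Lagrange.interpolate Finset.univ ν (fun A => u.repr (P (u A)) A))) =
      aeval T (Lagrange.interpolate Finset.univ ν (fun A => u.repr (P (u A)) A)) := by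
    rw [hT]
    exact (Polynomial.aeval_algHom_apply (Matrix.toLinAlgEquiv g).toAlgHom _ _).symm
  rw [this]
  apply u.ext
  intro A
  rw [aeval_basis T u ν hu, Lagrange.eval_interpolate_at_node _ hν.injOn (Finset.mem_univ A)]
  conv_lhs => rw [← u.sum_repr (P (u A))]
  rw [Finset.sum_eq_single A]
  · intro B _ hB; rw [hdiag B A hB]; simp
  · simp

lemma gal_prod {m : ℕ} {lam : Fin m → ℂ} (hgal : galoisActsFully m lam) (A B : Finset (Fin m))
    (h : ∏ i ∈ A, lam i = ∏ i ∈ B, lam i) (τ : Equiv.Perm (Fin m)) :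
    ∏ i ∈ A, lam (τ i) = ∏ i ∈ B, lam (τ i) := by
  obtain ⟨σ, hσ⟩ := hgal τ
  let l : Fin m → splittingFieldOfRoots m lam := fun i =>
    ⟨lam i, root_mem_splittingFieldOfRoots m lam i⟩
  have h' : ∏ i ∈ A, l i = ∏ i ∈ B, l i := by
    apply Subtype.ext
    simpa [l] using h
  have h2 := congrArg (fun z => ((σ z : splittingFieldOfRoots m lam) : ℂ)) h'
  simpa [l, hσ] using h2

lemma exists_mem_diff {m : ℕ} {A B : Finset (Fin m)} (hA : A.card = 2) (hB : B.card = 2)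
    (h : A ≠ B) : ∃ x b, x ≠ b ∧ A = {x, b} ∧ x ∉ B := by
  have : ¬ A ⊆ B := fun hs => h (Finset.eq_of_subset_of_card_le hs (by omega))
  obtain ⟨x, hx, hxB⟩ := Finset.not_subset.1 this
  obtain ⟨p, q, hpq, rfl⟩ := Finset.card_eq_two.1 hA
  simp only [Finset.mem_insert, Finset.mem_singleton] at hx
  rcases hx with rfl | rfl
  · exact ⟨x, q, hpq, rfl, hxB⟩
  · exact ⟨x, p, hpq.symm, Finset.pair_comm _ _, hxB⟩

lemma prod_inj {m : ℕ} (hm : 5 ≤ m) {lam : Fin m → ℂ} (hinj : Function.Injective lam)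
    (hgal : galoisActsFully m lam) {A B : Finset (Fin m)} (hA : A.card = 2) (hB : B.card = 2)
    (h : ∏ i ∈ A, lam i = ∏ i ∈ B, lam i) : A = B := by
  by_contra hne
  obtain ⟨x, b, hxb, rfl, hxB⟩ := exists_mem_diff hA hB hne
  have hb : lam b ≠ 0 := by
    intro h0
    have h1 : ∏ i ∈ ({b} : Finset (Fin m)), lam i = ∏ i ∈ ({b} : Finset (Fin m)), (0 : ℂ) := by
      simpa using h0
    obtain ⟨σ, hσ⟩ := hgal (Equiv.swap x b)
    have h2 := hσ b
    have h3 : (⟨lam b, root_mem_splittingFieldOfRoots m lam b⟩ : splittingFieldOfRoots m lam) = 0 :=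
      Subtype.ext h0
    rw [h3, map_zero, Equiv.swap_apply_right] at h2
    apply hxb
    apply hinj
    rw [h0, ← h2]; rfl
  obtain ⟨e, he⟩ : ∃ e, e ∉ ({x, b} ∪ B : Finset (Fin m)) := by
    by_contra hh
    push Not at hh
    have h1 : (Finset.univ : Finset (Fin m)) ⊆ {x, b} ∪ B := fun y _ => hh y
    have h2 := Finset.card_le_card h1
    have h3 := Finset.card_union_le ({x, b} : Finset (Fin m)) B
    rw [Finset.card_univ, Fintype.card_fin] at h2
    omega
  simp only [Finset.mem_union, Finset.mem_insert, Finset.mem_singleton, not_or] at he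
  obtain ⟨⟨hex, heb⟩, heB⟩ := he
  have h2 := gal_prod hgal _ _ h (Equiv.swap x e)
  have h3 : ∏ i ∈ B, lam (Equiv.swap x e i) = ∏ i ∈ B, lam i := by
    refine Finset.prod_congr rfl fun i hi => ?_
    rw [Equiv.swap_apply_of_ne_of_ne]
    · rintro rfl; exact hxB hi
    · rintro rfl; exact heB hi
  rw [h3, ← h, Finset.prod_pair hxb, Finset.prod_pair hxb, Equiv.swap_apply_left,
    Equiv.swap_apply_of_ne_of_ne hxb.symm (Ne.symm heb)] at h2
  exact hex (hinj (mul_right_cancel₀ hb h2))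

lemma exists_perm {m : ℕ} (I : Finset (Fin m)) (hI : 2 ≤ I.card) (hI' : I.card < m)
    {A B : Finset (Fin m)} (hA : A.card = 2) (hB : B.card = 2) (h : A ≠ B) :
    ∃ τ : Equiv.Perm (Fin m), (∀ i ∈ B, τ i ∈ I) ∧ ∃ x ∈ A, τ x ∉ I := by
  obtain ⟨x, b, hxb, rfl, hxB⟩ := exists_mem_diff hA hB h
  obtain ⟨c, d, hcd, rfl⟩ := Finset.card_eq_two.1 hB
  obtain ⟨p, hp, q, hq, hpq⟩ := Finset.one_lt_card.1 (show 1 < I.card by omega)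
  obtain ⟨y, hy⟩ : ∃ y, y ∉ I := by
    by_contra hh
    push Not at hh
    have h2 := Finset.card_le_card (fun y _ => hh y : (Finset.univ : Finset (Fin m)) ⊆ I)
    rw [Finset.card_univ, Fintype.card_fin] at h2
    omega
  simp only [Finset.mem_insert, Finset.mem_singleton, not_or] at hxB
  have hyp : y ≠ p := by rintro rfl; exact hy hp
  have hyq : y ≠ q := by rintro rfl; exact hy hq
  let f : Fin 3 ↪ Fin m := ⟨![x, c, d], by
    intro i j hij; fin_cases i <;> fin_cases j <;> simp_all⟩
  let g : Fin 3 ↪ Fin m := ⟨![y, p, q], by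
    intro i j hij; fin_cases i <;> fin_cases j <;> simp_all⟩
  obtain ⟨τ, hτ⟩ := (Equiv.Perm.isMultiplyPretransitive (Fin m) 3).exists_smul_eq f g
  have h0 := DFunLike.congr_fun hτ 0
  have h1 := DFunLike.congr_fun hτ 1
  have h2 := DFunLike.congr_fun hτ 2
  change τ x = y at h0
  change τ c = p at h1
  change τ d = q at h2
  refine ⟨τ, ?_, x, by simp, by rwa [h0]⟩
  intro i hi
  simp only [Finset.mem_insert, Finset.mem_singleton] at hi
  rcases hi with rfl | rfl
  · rwa [h1]
  · rwa [h2]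

lemma exists_eigenbasis (m : ℕ) (V : Type) [AddCommGroup V] [Module ℚ V] [FiniteDimensional ℚ V]
    (hdim : Module.finrank ℚ V = m) (φ : V →ₗ[ℚ] V)
    (lam : Fin m → ℂ) (hinj : Function.Injective lam)
    (hroot : ∀ i, Polynomial.aeval (lam i) (LinearMap.charpoly φ) = 0) :
    ∃ e : Basis (Fin m) ℂ (ℂ ⊗[ℚ] V), ∀ i, LinearMap.baseChange ℂ φ (e i) = lam i • e i := by
  have hev : ∀ i, End.HasEigenvalue (LinearMap.baseChange ℂ φ) (lam i) := by
    intro i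
    rw [Module.End.hasEigenvalue_iff_isRoot_charpoly, LinearMap.charpoly_baseChange]
    rw [IsRoot.def, eval_map_algebraMap]
    exact hroot i
  choose v hv using fun i => (hev i).exists_hasEigenvector
  have hli := Module.End.eigenvectors_linearIndependent' _ lam hinj v hv
  have hcard : Fintype.card (Fin m) = finrank ℂ (ℂ ⊗[ℚ] V) := by
    rw [Module.finrank_baseChange, hdim, Fintype.card_fin]
  by_cases hm : m = 0
  · subst hm
    have : Subsingleton (ℂ ⊗[ℚ] V) := Module.finrank_zero_iff.1 (by rw [← hcard]; simp)
    exact ⟨Basis.empty _, fun i => i.elim0⟩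
  have : Nonempty (Fin m) := ⟨⟨0, by omega⟩⟩
  refine ⟨basisOfLinearIndependentOfCardEqFinrank hli hcard, fun i => ?_⟩
  simpa using (hv i).apply_eq_smul

lemma exists_index_set {m : ℕ} {X : Type*} [AddCommGroup X] [Module ℂ X] (T : End ℂ X)
    (e : Basis (Fin m) ℂ X) (lam : Fin m → ℂ) (hinj : Function.Injective lam)
    (he : ∀ i, T (e i) = lam i • e i) (W : Submodule ℂ X) (hW : ∀ x ∈ W, T x ∈ W) :
    ∃ I : Finset (Fin m), (∀ i ∈ I, e i ∈ W) ∧ (∀ w ∈ W, ∀ i, i ∉ I → e.repr w i = 0) ∧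
      I.card = finrank ℂ W := by
  classical
  let I : Finset (Fin m) := Finset.univ.filter (fun i => e i ∈ W)
  have hI : ∀ w ∈ W, ∀ i, i ∉ I → e.repr w i = 0 := by
    intro w hw i hi
    by_contra hne
    apply hi
    simp only [I, Finset.mem_filter, Finset.mem_univ, true_and]
    have hp : ∀ p : ℂ[X], aeval T p w ∈ W := fun p =>
      Polynomial.aeval_apply_smul_mem_of_le_comap hw p T hW
    have h1 := hp (specPoly lam i)
    have h2 : aeval T (specPoly lam i) w =
        ((specPoly lam i).eval (lam i) * e.repr w i) • e i := by
      conv_lhs => rw [← e.sum_repr w]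
      rw [map_sum, Finset.sum_eq_single i]
      · rw [map_smul, aeval_basis T e lam he, smul_smul, mul_comm]
      · intro B _ hB
        rw [map_smul, aeval_basis T e lam he, specPoly_eval_ne lam hB]; simp
      · simp
    rw [h2] at h1
    exact (W.smul_mem_iff (mul_ne_zero (specPoly_eval_self lam hinj i) hne)).1 h1
  have hI2 : ∀ i ∈ I, e i ∈ W := fun i hi => by simpa [I] using hi
  refine ⟨I, hI2, hI, ?_⟩
  have hspan : W = Submodule.span ℂ (Set.range (fun i : I => e i)) := by
    apply le_antisymm
    · intro w hw
      rw [← e.sum_repr w]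
      refine Submodule.sum_mem _ fun i _ => ?_
      by_cases hi : i ∈ I
      · exact Submodule.smul_mem _ _ (Submodule.subset_span ⟨⟨i, hi⟩, rfl⟩)
      · rw [hI w hw i hi]; simp
    · rw [Submodule.span_le]
      rintro _ ⟨i, rfl⟩
      exact hI2 i i.2
  rw [hspan, finrank_span_eq_card]
  · simp
  · exact e.linearIndependent.comp _ Subtype.val_injective

section theta

variable (V : Type) [AddCommGroup V] [Module ℚ V]
    [Algebra ℚ (ExteriorAlgebra ℂ (ℂ ⊗[ℚ] V))]
    [IsScalarTower ℚ ℂ (ExteriorAlgebra ℂ (ℂ ⊗[ℚ] V))]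

lemma thetaA_ι (v : V) : thetaA V (ExteriorAlgebra.ι ℚ v) = ExteriorAlgebra.ι ℂ (iotaV V v) := by
  exact ExteriorAlgebra.lift_ι_apply ℚ _ _ v

lemma thetaA_smul (q : ℚ) (x : ExteriorAlgebra ℚ V) :
    thetaA V (q • x) = (algebraMap ℚ ℂ q) • thetaA V x := by
  have h : (algebraMap ℚ (ExteriorAlgebra ℂ (ℂ ⊗[ℚ] V))) =
      (algebraMap ℂ (ExteriorAlgebra ℂ (ℂ ⊗[ℚ] V))).comp (algebraMap ℚ ℂ) := RingHom.ext_rat _ _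
  rw [Algebra.smul_def, map_mul, AlgHom.commutes, h, Algebra.smul_def]
  rfl

lemma thetaA_ιMulti {k : ℕ} (v : Fin k → V) :
    thetaA V (ExteriorAlgebra.ιMulti ℚ k v) = ExteriorAlgebra.ιMulti ℂ k (iotaV V ∘ v) := by
  rw [ExteriorAlgebra.ιMulti_apply, ExteriorAlgebra.ιMulti_apply, map_list_prod, List.map_ofFn]
  congr 2
  funext i
  exact thetaA_ι V (v i)

lemma thetaA_map (φ : V →ₗ[ℚ] V) (x : ExteriorAlgebra ℚ V) :
    thetaA V (ExteriorAlgebra.map φ x) =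
      ExteriorAlgebra.map (LinearMap.baseChange ℂ φ) (thetaA V x) := by
  induction x using ExteriorAlgebra.induction with
  | algebraMap r =>
    rw [AlgHom.commutes, AlgHom.commutes, IsScalarTower.algebraMap_apply ℚ ℂ, AlgHom.commutes]
  | ι v =>
    rw [ExteriorAlgebra.map_apply_ι, thetaA_ι, thetaA_ι, ExteriorAlgebra.map_apply_ι]
    simp [iotaV]
  | mul a b ha hb => simp only [map_mul, ha, hb]
  | add a b ha hb => simp only [map_add, ha, hb]

lemma thetaA_basis {m : ℕ} (b : Basis (Fin m) ℚ V) (A : Set.powersetCard (Fin m) 2) :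
    thetaA V (b.exteriorPower 2 A : ⋀[ℚ]^2 V) =
      (((b.baseChange ℂ).exteriorPower 2 A : ⋀[ℂ]^2 (ℂ ⊗[ℚ] V)) :
        ExteriorAlgebra ℂ (ℂ ⊗[ℚ] V)) := by
  rw [exteriorPower.basis_apply, exteriorPower.basis_apply,
    exteriorPower.ιMulti_family_apply_coe, exteriorPower.ιMulti_family_apply_coe,
    ExteriorAlgebra.ιMulti_family, ExteriorAlgebra.ιMulti_family, thetaA_ιMulti]
  congr 1
  funext i
  simp [iotaV]

lemma complexify_coe {m : ℕ} (b : Basis (Fin m) ℚ V) (ψ : Module.End ℚ ↥(⋀[ℚ]^2 V))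
    (F : Module.End ℂ (ExteriorAlgebra ℂ (ℂ ⊗[ℚ] V)))
    (hF : ∀ v : ↥(⋀[ℚ]^2 V), F (thetaA V ↑v) = thetaA V ↑(ψ v)) (x : ⋀[ℂ]^2 (ℂ ⊗[ℚ] V)) :
    ((Matrix.toLinAlgEquiv ((b.baseChange ℂ).exteriorPower 2) ((algebraMap ℚ ℂ).mapMatrix
      (LinearMap.toMatrixAlgEquiv (b.exteriorPower 2) ψ)) x : ⋀[ℂ]^2 (ℂ ⊗[ℚ] V)) :
      ExteriorAlgebra ℂ (ℂ ⊗[ℚ] V)) = F x := by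
  set g := (b.baseChange ℂ).exteriorPower 2 with hg
  set M := LinearMap.toMatrixAlgEquiv (b.exteriorPower 2) ψ with hM
  suffices h : (⋀[ℂ]^2 (ℂ ⊗[ℚ] V)).subtype ∘ₗ
      (Matrix.toLinAlgEquiv g ((algebraMap ℚ ℂ).mapMatrix M)) =
      F ∘ₗ (⋀[ℂ]^2 (ℂ ⊗[ℚ] V)).subtype from LinearMap.congr_fun h x
  apply g.ext
  intro A
  have h1 : ψ (b.exteriorPower 2 A) = ∑ C, M C A • b.exteriorPower 2 C := by
    conv_lhs => rw [← (b.exteriorPower 2).sum_repr (ψ (b.exteriorPower 2 A))]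
    refine Finset.sum_congr rfl fun C _ => ?_
    rw [hM, LinearMap.toMatrixAlgEquiv_apply]
  simp only [LinearMap.comp_apply, Submodule.subtype_apply]
  rw [hg, ← thetaA_basis V b A, hF, h1, ← hg, Matrix.toLinAlgEquiv_self]
  simp only [Submodule.coe_sum, Submodule.coe_smul, map_sum, thetaA_smul, thetaA_basis]
  refine Finset.sum_congr rfl fun C _ => ?_
  simp only [RingHom.mapMatrix_apply, Matrix.map_apply, hg]

end theta

lemma conj_invariant (V : Type) [AddCommGroup V] [Module ℚ V] (φ : V →ₗ[ℚ] V)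
    (x : ℂ ⊗[ℚ] V) : LinearMap.baseChange ℂ φ (conjV V x) = conjV V (LinearMap.baseChange ℂ φ x) := by
  induction x using TensorProduct.induction_on with
  | zero => simp
  | tmul z v => simp [conjV]
  | add a b ha hb => simp only [map_add, ha, hb]

lemma hodge_invariant (V : Type) [AddCommGroup V] [Module ℚ V] (φ : V →ₗ[ℚ] V)
    (W : Submodule ℂ (ℂ ⊗[ℚ] V)) (hWinv : ∀ x ∈ W, LinearMap.baseChange ℂ φ x ∈ W)
    (k p : ℕ) (x) (hx : x ∈ hodgeComp V W k p) :
    ExteriorAlgebra.map (LinearMap.baseChange ℂ φ) x ∈ hodgeComp V W k p := by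
  unfold hodgeComp at hx ⊢
  induction hx using Submodule.span_induction with
  | mem x hx =>
    obtain ⟨v, hv, rfl⟩ := hx
    rw [ExteriorAlgebra.map_apply_ιMulti]
    refine Submodule.subset_span ⟨_, fun i => ⟨fun hi => hWinv _ ((hv i).1 hi), fun hi => ?_⟩, rfl⟩
    obtain ⟨w, hw, hw2⟩ := (hv i).2 hi
    refine ⟨LinearMap.baseChange ℂ φ w, hWinv _ hw, ?_⟩
    rw [← conj_invariant, hw2]
  | zero => rw [map_zero]; exact Submodule.zero_mem _
  | add x y _ _ hx hy => rw [map_add]; exact Submodule.add_mem _ hx hy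
  | smul a x _ hx => rw [map_smul]; exact Submodule.smul_mem _ _ hx

lemma hodge_two_coord (V : Type) [AddCommGroup V] [Module ℚ V]
    (W : Submodule ℂ (ℂ ⊗[ℚ] V)) {m : ℕ} (e : Basis (Fin m) ℂ (ℂ ⊗[ℚ] V)) (I : Finset (Fin m))
    (hI : ∀ w ∈ W, ∀ i, i ∉ I → e.repr w i = 0)
    (A : Set.powersetCard (Fin m) 2) (a : Fin m) (ha : a ∈ A) (haI : a ∉ I)
    (y : ⋀[ℂ]^2 (ℂ ⊗[ℚ] V)) (hy : (y : ExteriorAlgebra ℂ (ℂ ⊗[ℚ] V)) ∈ hodgeComp V W 2 2) :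
    (e.exteriorPower 2).repr y A = 0 := by
  suffices h : hodgeComp V W 2 2 ≤ Submodule.map (⋀[ℂ]^2 (ℂ ⊗[ℚ] V)).subtype
      (LinearMap.ker ((e.exteriorPower 2).coord A)) by
    obtain ⟨z, hz, hzy⟩ := h hy
    have : z = y := Subtype.ext hzy
    subst this
    exact hz
  unfold hodgeComp
  rw [Submodule.span_le]
  rintro _ ⟨v, hv, rfl⟩
  refine ⟨exteriorPower.ιMulti ℂ 2 v, ?_, rfl⟩
  rw [SetLike.mem_coe, LinearMap.mem_ker, exteriorPower.basis_coord,
    exteriorPower.ιMultiDual_apply_ιMulti]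
  obtain ⟨k, hk⟩ := (Set.powersetCard.mem_range_ofFinEmbEquiv_symm_iff_mem A a).mpr ha
  apply Matrix.det_eq_zero_of_column_eq_zero k
  intro i
  rw [Matrix.of_apply, hk, Basis.coord_apply]
  exact hI _ ((hv i).1 i.2) a haI

/-- the permutation of two-element subsets induced by a permutation -/
def pairPerm {m : ℕ} (τ : Equiv.Perm (Fin m)) : Equiv.Perm (Set.powersetCard (Fin m) 2) where
  toFun A := ⟨A.1.map τ.toEmbedding, by
    have := A.2
    simpa using this⟩
  invFun A := ⟨A.1.map τ.symm.toEmbedding, by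
    have := A.2
    simpa using this⟩
  left_inv A := by
    apply Subtype.ext
    ext i
    simp
  right_inv A := by
    apply Subtype.ext
    ext i
    simp

end helpers

/-- Under condition (*) (`n ≥ 4`), every endomorphism of the Hodge structure
on `⋀²V` is a polynomial in `⋀²φ`: a `ℚ`-linear endomorphism `ψ` of `⋀²V` whose
complexification `Ψ` maps each of the `(2,0)`-, `(1,1)`- and `(0,2)`-components of
`⋀²(ℂ ⊗ V)` into itself is exactly an element of the `ℚ`-subalgebra of `End(⋀²V)` generated
by `⋀²φ`. -/
theorem hodge_endomorphisms_generated_by_extPow_two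
    (n : ℕ) (hn : 4 ≤ n)
    (V : Type) [AddCommGroup V] [Module ℚ V] [FiniteDimensional ℚ V]
    (hdim : Module.finrank ℚ V = 2 * n)
    (φ : V →ₗ[ℚ] V)
    (lam : Fin (2 * n) → ℂ) (hinj : Function.Injective lam)
    (hroot : ∀ i, Polynomial.aeval (lam i) (LinearMap.charpoly φ) = 0)
    (hgal : galoisActsFully (2 * n) lam)
    (W : Submodule ℂ (ℂ ⊗[ℚ] V))
    (hWdim : Module.finrank ℂ W = n)
    (hWinv : ∀ x ∈ W, LinearMap.baseChange ℂ φ x ∈ W)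
    (hWsup : W.restrictScalars ℚ ⊔ conjSub V W = ⊤)
    (hWinf : W.restrictScalars ℚ ⊓ conjSub V W = ⊥)
    [Algebra ℚ (ExteriorAlgebra ℂ (ℂ ⊗[ℚ] V))]
    [IsScalarTower ℚ ℂ (ExteriorAlgebra ℂ (ℂ ⊗[ℚ] V))] :
    ∀ ψ : Module.End ℚ ↥(⋀[ℚ]^2 V),
      ((∃ Ψ : Module.End ℂ (ExteriorAlgebra ℂ (ℂ ⊗[ℚ] V)),
          (∀ v : ↥(⋀[ℚ]^2 V), Ψ (thetaA V ↑v) = thetaA V ↑(ψ v)) ∧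
          (∀ p : Fin 3, ∀ x ∈ hodgeComp V W 2 p, Ψ x ∈ hodgeComp V W 2 p))
        ↔ ψ ∈ Algebra.adjoin ℚ ({extPowMap V φ 2} : Set (Module.End ℚ ↥(⋀[ℚ]^2 V)))) := by
  classical
  intro ψ
  constructor
  · rintro ⟨Ψ, hΨ, hH⟩
    obtain ⟨e, he⟩ := exists_eigenbasis (2 * n) V hdim φ lam hinj hroot
    obtain ⟨I, hIW, hI, hIcard⟩ := exists_index_set _ e lam hinj he W hWinv
    rw [hWdim] at hIcard
    let b : Module.Basis (Fin (2 * n)) ℚ V := Module.finBasisOfFinrankEq ℚ V hdim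
    let gQ := b.exteriorPower 2
    let g := (b.baseChange ℂ).exteriorPower 2
    let u := e.exteriorPower 2
    let T' := Matrix.toLinAlgEquiv g ((algebraMap ℚ ℂ).mapMatrix
      (LinearMap.toMatrixAlgEquiv gQ (extPowMap V φ 2)))
    let P' := Matrix.toLinAlgEquiv g ((algebraMap ℚ ℂ).mapMatrix (LinearMap.toMatrixAlgEquiv gQ ψ))
    have hT' : ∀ x, ((T' x : ⋀[ℂ]^2 (ℂ ⊗[ℚ] V)) : ExteriorAlgebra ℂ (ℂ ⊗[ℚ] V)) =
        (ExteriorAlgebra.map (LinearMap.baseChange ℂ φ)).toLinearMap x := by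
      apply complexify_coe V b (extPowMap V φ 2)
      intro v
      exact (thetaA_map V φ v).symm
    have hP' : ∀ x, ((P' x : ⋀[ℂ]^2 (ℂ ⊗[ℚ] V)) : ExteriorAlgebra ℂ (ℂ ⊗[ℚ] V)) = Ψ x :=
      complexify_coe V b ψ Ψ hΨ
    let l : Fin (2 * n) → splittingFieldOfRoots (2 * n) lam := fun i =>
      ⟨lam i, root_mem_splittingFieldOfRoots (2 * n) lam i⟩
    let μ : Set.powersetCard (Fin (2 * n)) 2 → splittingFieldOfRoots (2 * n) lam :=
      fun A => ∏ i ∈ A.1, l i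
    have hμ : ∀ A, (μ A : ℂ) = ∏ i ∈ A.1, lam i := by
      intro A
      simp [μ, l]
    have huA : ∀ A, (u A : ExteriorAlgebra ℂ (ℂ ⊗[ℚ] V)) = ExteriorAlgebra.ιMulti ℂ 2
        (e ∘ (Set.powersetCard.ofFinEmbEquiv.symm A)) := by
      intro A
      simp only [u]
      rw [exteriorPower.basis_apply]
      rfl
    have hmem : LinearMap.toMatrixAlgEquiv gQ ψ ∈ Algebra.adjoin ℚ
        ({LinearMap.toMatrixAlgEquiv gQ (extPowMap V φ 2)} : Set (Matrix _ _ ℚ)) := by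
      refine core (splittingFieldOfRoots (2 * n) lam) _ _ g u T' P' rfl rfl μ ?_ ?_ ?_
      · intro A B hAB
        apply Subtype.ext
        refine prod_inj (by omega) hinj hgal A.2 B.2 ?_
        rw [← hμ, ← hμ, hAB]
      · intro A
        apply Subtype.ext
        rw [hT', hμ, Submodule.coe_smul, huA, AlgHom.toLinearMap_apply,
          ExteriorAlgebra.map_apply_ιMulti]
        have h1 : (⇑(LinearMap.baseChange ℂ φ) ∘ ⇑e ∘ ⇑(Set.powersetCard.ofFinEmbEquiv.symm A)) =
            fun i => lam (Set.powersetCard.ofFinEmbEquiv.symm A i) •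
              (e ∘ (Set.powersetCard.ofFinEmbEquiv.symm A)) i := by
          funext i
          simp [he]
        rw [h1, AlternatingMap.map_smul_univ]
        congr 1
        rw [← Finset.prod_coe_sort A.1 lam]
        exact Fintype.prod_equiv (A.1.orderIsoOfFin A.2).toEquiv _ _ (fun i => rfl)
      · intro A B hAB
        obtain ⟨τ, hτB, x, hxA, hτx⟩ := exists_perm I (by omega) (by omega) A.2 B.2
          (fun h => hAB (Subtype.ext h))
        obtain ⟨σ, hσ⟩ := hgal τ
        refine ⟨σ, pairPerm τ, ?_, ?_⟩
        · intro C
          simp only [μ, map_prod, pairPerm, Equiv.coe_fn_mk, Finset.prod_map]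
          refine Finset.prod_congr rfl fun i _ => ?_
          exact Subtype.ext (hσ i)
        · refine hodge_two_coord V W e I hI (pairPerm τ A) (τ x) ?_ hτx _ ?_
          · change τ x ∈ A.1.map τ.toEmbedding
            simpa using hxA
          · rw [hP']
            refine hH 2 _ ?_
            rw [huA]
            refine Submodule.subset_span ⟨_, fun i => ⟨fun _ => ?_, fun hi => ?_⟩, rfl⟩
            · have h1 : Set.powersetCard.ofFinEmbEquiv.symm (pairPerm τ B) i ∈ pairPerm τ B :=
                (Set.powersetCard.mem_range_ofFinEmbEquiv_symm_iff_mem _ _).1 ⟨i, rfl⟩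
              change _ ∈ B.1.map τ.toEmbedding at h1
              obtain ⟨j, hj, hj2⟩ := Finset.mem_map.1 h1
              apply hIW
              rw [← hj2]
              exact hτB j hj
            · exact absurd i.2 (not_lt.2 hi)
    rw [Algebra.adjoin_singleton_eq_range_aeval] at hmem ⊢
    obtain ⟨p, hp⟩ := hmem
    refine ⟨p, (LinearMap.toMatrixAlgEquiv gQ).injective ?_⟩
    rw [← hp]
    exact (Polynomial.aeval_algHom_apply (LinearMap.toMatrixAlgEquiv gQ).toAlgHom _ _).symm
  · intro h
    induction h using Algebra.adjoin_induction with
    | mem x hx =>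
      rw [Set.mem_singleton_iff] at hx
      subst hx
      refine ⟨(ExteriorAlgebra.map (LinearMap.baseChange ℂ φ)).toLinearMap, ?_, ?_⟩
      · intro v
        exact (thetaA_map V φ v).symm
      · intro p x hx
        exact hodge_invariant V φ W hWinv 2 p x hx
    | algebraMap r =>
      refine ⟨algebraMap ℂ _ (algebraMap ℚ ℂ r), ?_, ?_⟩
      · intro v
        rw [Module.algebraMap_end_apply, Module.algebraMap_end_apply, Submodule.coe_smul,
          thetaA_smul]
      · intro p x hx
        rw [Module.algebraMap_end_apply]
        exact Submodule.smul_mem _ _ hx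
    | add x y _ _ hx hy =>
      obtain ⟨X, hX, hX2⟩ := hx
      obtain ⟨Y, hY, hY2⟩ := hy
      refine ⟨X + Y, ?_, ?_⟩
      · intro v
        rw [LinearMap.add_apply, LinearMap.add_apply, hX, hY, Submodule.coe_add, map_add]
      · intro p z hz
        exact Submodule.add_mem _ (hX2 p z hz) (hY2 p z hz)
    | mul x y _ _ hx hy =>
      obtain ⟨X, hX, hX2⟩ := hx
      obtain ⟨Y, hY, hY2⟩ := hy
      refine ⟨X * Y, ?_, ?_⟩
      · intro v
        rw [Module.End.mul_apply, Module.End.mul_apply, hY, hX]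
      · intro p z hz
        exact hX2 p _ (hY2 p z hz)

end VoisinPaper
end
end

section
/- Let Hdg ⊆ ∧²V* ⊗ ∧²V denote the ℚ-subspace of Hodge classes, i.e. rational elements whose image in ℂ ⊗ (∧²V* ⊗ ∧²V) lies in the (2,2)-component of the weight-4 Hodge decomposition. Let e_1, …, e_{2n} be a basis of V_ℂ of eigenvectors of φ_ℂ with φ_ℂ(e_i) = λ_i e_i, ordered so that W = span(e_1,…,e_n), and let e_i* be the dual basis of V*_ℂ. Then ℂ ⊗ Hdg equals the ℂ-span of the elements e_i*∧e_j* ⊗ e_i∧e_j for 1 ≤ i < j ≤ 2n. Consequently, every nonzero decomposable element α ⊗ β of ℂ ⊗ Hdg (with α ∈ ∧²V*_ℂ, β ∈ ∧²V_ℂ) is a scalar multiple of some e_i*∧e_j* ⊗ e_i∧e_j; in particular, up to scalar, ℂ ⊗ Hdg contains only finitely many elements of rank one. (This is Lemma 'plustard2' of the paper.) -/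
open scoped TensorProduct

set_option maxHeartbeats 1000000
set_option synthInstance.maxHeartbeats 400000

noncomputable section

namespace VoisinPaper

/-- The dual of the complexification of `V`. -/
abbrev DualVC (V : Type) [AddCommGroup V] [Module ℚ V] := Module.Dual ℂ (ℂ ⊗[ℚ] V)

/-- The exterior algebra of the complexification of `V`. -/
abbrev ExtC (V : Type) [AddCommGroup V] [Module ℚ V] := ExteriorAlgebra ℂ (ℂ ⊗[ℚ] V)

/-- The exterior algebra of the dual of the complexification of `V`. -/
abbrev ExtD (V : Type) [AddCommGroup V] [Module ℚ V] := ExteriorAlgebra ℂ (DualVC V)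

/-- A `ℂ`-linear functional on `ℂ ⊗ V` is rational if it takes rational values on `1 ⊗ V`;
rational functionals are exactly the complexifications of `ℚ`-linear functionals on `V`. -/
def isRatFunctional (V : Type) [AddCommGroup V] [Module ℚ V] (f : DualVC V) : Prop :=
  ∀ x : V, ∃ r : ℚ, f (iotaV V x) = (r : ℂ)

/-- The rational points of `⋀²(V*)_ℂ`: the `ℚ`-span of wedges of rational functionals; this
is the image of `⋀² V*` in `⋀²(V*)_ℂ`. -/
def ratDual2 (V : Type) [AddCommGroup V] [Module ℚ V]
    [Module ℚ (ExtD V)] [IsScalarTower ℚ ℂ (ExtD V)] : Submodule ℚ (ExtD V) :=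
  Submodule.span ℚ {x | ∃ fg : Fin 2 → DualVC V, (∀ i, isRatFunctional V (fg i)) ∧
    x = ExteriorAlgebra.ιMulti ℂ 2 fg}

/-- The `(p, 2-p)` Hodge component of `⋀²(V*)_ℂ`, for the weight-1 Hodge structure on `V*`
whose `(1,0)`-part is the annihilator of `W` (so its `(0,1)`-part is the annihilator of
`c(W)`). -/
def dualHodgeComp (V : Type) [AddCommGroup V] [Module ℚ V] (W : Submodule ℂ (ℂ ⊗[ℚ] V))
    (p : ℕ) : Submodule ℂ (ExtD V) :=
  Submodule.span ℂ {x | ∃ fg : Fin 2 → DualVC V,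
    (∀ i : Fin 2, ((i : ℕ) < p → ∀ y ∈ W, fg i y = 0) ∧
      (p ≤ (i : ℕ) → ∀ y ∈ conjSub V W, fg i y = 0)) ∧
    x = ExteriorAlgebra.ιMulti ℂ 2 fg}

/-- The rational points of `⋀²V*_ℂ ⊗ ⋀²V_ℂ`: the `ℚ`-span of tensors of rational points of the
two factors; this is the image of `⋀²V* ⊗ ⋀²V`. -/
def ratTensor11 (V : Type) [AddCommGroup V] [Module ℚ V]
    [Algebra ℚ (ExtC V)] [IsScalarTower ℚ ℂ (ExtC V)]
    [Module ℚ (ExtD V)] [IsScalarTower ℚ ℂ (ExtD V)]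
    [Module ℚ (ExtD V ⊗[ℂ] ExtC V)] [IsScalarTower ℚ ℂ (ExtD V ⊗[ℂ] ExtC V)] :
    Submodule ℚ (ExtD V ⊗[ℂ] ExtC V) :=
  Submodule.span ℚ {t : ExtD V ⊗[ℂ] ExtC V | ∃ (d : ExtD V) (b : ExteriorAlgebra ℚ V),
    d ∈ ratDual2 V ∧ b ∈ ⋀[ℚ]^2 V ∧ t = d ⊗ₜ[ℂ] thetaA V b}

/-- The `(2,2)` Hodge component of the weight-4 Hodge structure on `⋀²V*_ℂ ⊗ ⋀²V_ℂ`. -/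
def hodge22Tensor11 (V : Type) [AddCommGroup V] [Module ℚ V]
    (W : Submodule ℂ (ℂ ⊗[ℚ] V)) : Submodule ℂ (ExtD V ⊗[ℂ] ExtC V) :=
  Submodule.span ℂ {t : ExtD V ⊗[ℂ] ExtC V | ∃ p₁ p₂ : ℕ, p₁ ≤ 2 ∧ p₂ ≤ 2 ∧ p₁ + p₂ = 2 ∧
    ∃ (d : ExtD V) (b : ExtC V),
      d ∈ dualHodgeComp V W p₁ ∧ b ∈ hodgeComp V W 2 p₂ ∧ t = d ⊗ₜ[ℂ] b}

/-- The space `Hdg` of Hodge classes in `⋀²V* ⊗ ⋀²V`: rational elements whose image in the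
complexification is of type `(2,2)`. -/
def hodgeClasses11 (V : Type) [AddCommGroup V] [Module ℚ V]
    (W : Submodule ℂ (ℂ ⊗[ℚ] V))
    [Algebra ℚ (ExtC V)] [IsScalarTower ℚ ℂ (ExtC V)]
    [Module ℚ (ExtD V)] [IsScalarTower ℚ ℂ (ExtD V)]
    [Module ℚ (ExtD V ⊗[ℂ] ExtC V)] [IsScalarTower ℚ ℂ (ExtD V ⊗[ℂ] ExtC V)] :
    Submodule ℚ (ExtD V ⊗[ℂ] ExtC V) :=
  ratTensor11 V ⊓ (hodge22Tensor11 V W).restrictScalars ℚ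

/-- The standard Hodge classes `e_i^* ∧ e_j^* ⊗ e_i ∧ e_j` attached to a basis `e` of
`ℂ ⊗ V`. -/
def stdHodgeElt (V : Type) [AddCommGroup V] [Module ℚ V] {m : ℕ}
    (e : Module.Basis (Fin m) ℂ (ℂ ⊗[ℚ] V)) (i j : Fin m) : ExtD V ⊗[ℂ] ExtC V :=
  (ExteriorAlgebra.ιMulti ℂ 2 ![e.dualBasis i, e.dualBasis j]) ⊗ₜ[ℂ]
    (ExteriorAlgebra.ιMulti ℂ 2 ![e i, e j])

/-- Two uncountable algebraically closed extensions of a countable field of the same cardinality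
are isomorphic over the base. -/
lemma exists_ringEquiv_over {R K L : Type} [Field R] [Field K] [Field L] [Algebra R K] [Algebra R L]
    [IsAlgClosed K] [IsAlgClosed L] (hR : Cardinal.mk R ≤ Cardinal.aleph0)
    (hK : Cardinal.aleph0 < Cardinal.mk K) (hKL : Cardinal.mk K = Cardinal.mk L) :
    ∃ E : K ≃+* L, ∀ r : R, E (algebraMap R K r) = algebraMap R L r := by
  obtain ⟨s, hs⟩ := exists_isTranscendenceBasis R K
  obtain ⟨t, ht⟩ := exists_isTranscendenceBasis R L
  have h1 := IsAlgClosed.cardinal_eq_cardinal_transcendence_basis_of_aleph0_lt' _ hs hR hK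
  have h2 := IsAlgClosed.cardinal_eq_cardinal_transcendence_basis_of_aleph0_lt' _ ht hR (hKL ▸ hK)
  obtain ⟨e⟩ := Cardinal.eq.1 (h1.symm.trans (hKL.trans h2))
  let v : s → K := (↑)
  let w : t → L := (↑)
  let := IsAlgClosed.isAlgClosure_of_transcendence_basis v hs
  let := IsAlgClosed.isAlgClosure_of_transcendence_basis w ht
  let E : Algebra.adjoin R (Set.range v) ≃ₐ[R] Algebra.adjoin R (Set.range w) :=
    (hs.1.aevalEquiv.symm.trans (MvPolynomial.renameEquiv R e)).trans ht.1.aevalEquiv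
  refine ⟨IsAlgClosure.equivOfEquiv K L E.toRingEquiv, fun r => ?_⟩
  have h := IsAlgClosure.equivOfEquiv_algebraMap K L E.toRingEquiv
    (algebraMap R (Algebra.adjoin R (Set.range v)) r)
  have h3 : E.toRingEquiv (algebraMap R (Algebra.adjoin R (Set.range v)) r)
      = algebraMap R (Algebra.adjoin R (Set.range w)) r := E.commutes r
  rw [h3] at h
  exact h

/-- Galois automorphisms of a subfield of `ℂ` algebraic over `ℚ` extend to `ℂ`. -/
lemma exists_complex_aut (K : IntermediateField ℚ ℂ) [Algebra.IsAlgebraic ℚ K] (σ : K ≃ₐ[ℚ] K) :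
    ∃ E : ℂ ≃+* ℂ, ∀ x : K, E (x : ℂ) = (σ x : ℂ) := by
  have hc : Cardinal.mk K ≤ Cardinal.aleph0 := by
    have := Algebra.IsAlgebraic.cardinalMk_le_max ℚ K
    simpa using this
  have hC : Cardinal.aleph0 < Cardinal.mk ℂ := by
    rw [Cardinal.mk_complex]; exact Cardinal.aleph0_lt_continuum
  obtain ⟨E, hE⟩ := @exists_ringEquiv_over K ℂ ℂ _ _ _ _
    ((algebraMap K ℂ).comp (σ : K →+* K)).toAlgebra _ _ hc hC rfl
  exact ⟨E, hE⟩

lemma exists_aut_of_gal {m : ℕ} (lam : Fin m → ℂ) (halg : ∀ i, IsAlgebraic ℚ (lam i))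
    (hgal : galoisActsFully m lam) (τ : Equiv.Perm (Fin m)) :
    ∃ E : ℂ ≃+* ℂ, ∀ i, E (lam i) = lam (τ i) := by
  obtain ⟨σ, hσ⟩ := hgal τ
  have : Algebra.IsAlgebraic ℚ (splittingFieldOfRoots m lam) := by
    apply IntermediateField.isAlgebraic_adjoin
    rintro x ⟨i, rfl⟩
    exact (halg i).isIntegral
  obtain ⟨E, hE⟩ := exists_complex_aut _ σ
  exact ⟨E, fun i => by rw [← hσ i, ← hE]⟩

/-- Evaluation of two functionals on the degree two part of the exterior algebra. -/
def wedgePair {M : Type} [AddCommGroup M] [Module ℂ M] (p q : Module.Dual ℂ M) :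
    ExteriorAlgebra ℂ M →ₗ[ℂ] ℂ :=
  ExteriorAlgebra.liftAlternating (fun i =>
    if h : i = 2 then
      h ▸ (Matrix.detRowAlternating (n := Fin 2) (R := ℂ)).compLinearMap (LinearMap.pi ![p, q])
    else 0)

lemma wedgePair_apply {M : Type} [AddCommGroup M] [Module ℂ M] (p q : Module.Dual ℂ M)
    (v : Fin 2 → M) :
    wedgePair p q (ExteriorAlgebra.ιMulti ℂ 2 v) = p (v 0) * q (v 1) - p (v 1) * q (v 0) := by
  rw [wedgePair, ExteriorAlgebra.liftAlternating_apply_ιMulti]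
  have h : (Matrix.detRowAlternating fun i => (LinearMap.pi ![p, q]) (v i) : ℂ)
      = Matrix.det (Matrix.of fun i => (LinearMap.pi ![p, q]) (v i)) := rfl
  simp only [dif_pos, AlternatingMap.compLinearMap_apply]
  rw [h, Matrix.det_fin_two]
  simp
  ring

lemma iMulti_two {M : Type} [AddCommGroup M] [Module ℂ M] (v : Fin 2 → M) :
    ExteriorAlgebra.ιMulti ℂ 2 v = ExteriorAlgebra.ι ℂ (v 0) * ExteriorAlgebra.ι ℂ (v 1) := by
  simp only [ExteriorAlgebra.ιMulti_apply, List.ofFn_succ, List.ofFn_zero, List.prod_cons,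
    List.prod_nil, mul_one]
  rfl

lemma iMulti_swap {M : Type} [AddCommGroup M] [Module ℂ M] (x y : M) :
    ExteriorAlgebra.ιMulti ℂ 2 ![y, x] = - ExteriorAlgebra.ιMulti ℂ 2 ![x, y] := by
  rw [iMulti_two, iMulti_two]
  exact eq_neg_of_add_eq_zero_left (ExteriorAlgebra.ι_add_mul_swap _ _)

lemma iMulti_self {M : Type} [AddCommGroup M] [Module ℂ M] (x : M) :
    ExteriorAlgebra.ιMulti ℂ 2 ![x, x] = 0 := by
  rw [iMulti_two]
  exact ExteriorAlgebra.ι_sq_zero _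

/-- Reconstruction of an element of degree two from its coordinates. -/
lemma wedge_recon {M : Type} [AddCommGroup M] [Module ℂ M] {m : ℕ}
    (b : Module.Basis (Fin m) ℂ M) (x : ExteriorAlgebra ℂ M) (hx : x ∈ ⋀[ℂ]^2 M) :
    x = ∑ i, ∑ j, ((1 / 2 : ℂ) * wedgePair (b.coord i) (b.coord j) x) •
      ExteriorAlgebra.ιMulti ℂ 2 ![b i, b j] := by
  rw [← ExteriorAlgebra.ιMulti_span_fixedDegree] at hx
  induction hx using Submodule.span_induction with
  | mem x h =>
    obtain ⟨v, rfl⟩ := h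
    have key : ExteriorAlgebra.ιMulti ℂ 2 v = ∑ i, ∑ j, (b.coord i (v 0) * b.coord j (v 1)) •
      ExteriorAlgebra.ιMulti ℂ 2 ![b i, b j] := by
      conv_lhs => rw [iMulti_two, ← b.sum_repr (v 0), ← b.sum_repr (v 1)]
      simp only [map_sum, map_smul, Finset.sum_mul_sum, iMulti_two, smul_mul_smul_comm]
      rfl
    have key2 : ExteriorAlgebra.ιMulti ℂ 2 v = ∑ i, ∑ j, -((b.coord i (v 1) * b.coord j (v 0)) •
      ExteriorAlgebra.ιMulti ℂ 2 ![b i, b j]) := by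
      rw [key, Finset.sum_comm]
      refine Finset.sum_congr rfl fun i _ => Finset.sum_congr rfl fun j _ => ?_
      rw [iMulti_swap (b i) (b j), smul_neg, mul_comm]
    have : ExteriorAlgebra.ιMulti ℂ 2 v =
        (1 / 2 : ℂ) • (ExteriorAlgebra.ιMulti ℂ 2 v + ExteriorAlgebra.ιMulti ℂ 2 v) := by
      rw [← two_smul ℂ, smul_smul]; norm_num
    rw [this]
    nth_rewrite 1 [key]
    nth_rewrite 1 [key2]
    rw [← this]
    simp only [wedgePair_apply, ← Finset.sum_add_distrib, Finset.smul_sum]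
    refine Finset.sum_congr rfl fun i _ => Finset.sum_congr rfl fun j _ => ?_
    rw [← sub_eq_add_neg, ← sub_smul, smul_smul]
  | zero => simp
  | add x y _ _ hx hy =>
    conv_lhs => rw [hx, hy]
    simp only [map_add, mul_add, add_smul, Finset.sum_add_distrib]
  | smul a x _ hx =>
    conv_lhs => rw [hx]
    simp only [map_smul, Finset.smul_sum, smul_smul, smul_eq_mul]
    refine Finset.sum_congr rfl fun i _ => Finset.sum_congr rfl fun j _ => ?_
    congr 1; ring

lemma iMulti_two_rat {M : Type} [AddCommGroup M] [Module ℚ M] (v : Fin 2 → M) :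
    ExteriorAlgebra.ιMulti ℚ 2 v = ExteriorAlgebra.ι ℚ (v 0) * ExteriorAlgebra.ι ℚ (v 1) := by
  simp only [ExteriorAlgebra.ιMulti_apply, List.ofFn_succ, List.ofFn_zero, List.prod_cons,
    List.prod_nil, mul_one]
  rfl

lemma rat_smul_eq {M : Type} [AddCommGroup M] [Module ℂ M] [Module ℚ M] [IsScalarTower ℚ ℂ M]
    (q : ℚ) (x : M) : q • x = (q : ℂ) • x := by
  rw [← algebraMap_smul ℂ q x]; rfl

/-- The semilinear action of a field automorphism of `ℂ` on `ℂ ⊗ V`. -/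
def autV (V : Type) [AddCommGroup V] [Module ℚ V] (E : ℂ ≃+* ℂ) : ℂ ⊗[ℚ] V →ₗ[ℚ] ℂ ⊗[ℚ] V :=
  TensorProduct.map (E.toRingHom.toRatAlgHom.toLinearMap) LinearMap.id

section aut
variable {V : Type} [AddCommGroup V] [Module ℚ V] (E : ℂ ≃+* ℂ)

lemma autV_tmul (z : ℂ) (v : V) : autV V E (z ⊗ₜ v) = E z ⊗ₜ v := rfl

lemma autV_smul (z : ℂ) (x : ℂ ⊗[ℚ] V) : autV V E (z • x) = E z • autV V E x := by
  induction x using TensorProduct.induction_on with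
  | zero => simp
  | tmul a v => simp [autV_tmul, TensorProduct.smul_tmul']
  | add x y hx hy => simp [hx, hy, smul_add]

lemma autV_iota (v : V) : autV V E (iotaV V v) = iotaV V v := by
  simp [iotaV, autV_tmul]

lemma autV_phi (φ : V →ₗ[ℚ] V) (x : ℂ ⊗[ℚ] V) :
    LinearMap.baseChange ℂ φ (autV V E x) = autV V E (LinearMap.baseChange ℂ φ x) := by
  induction x using TensorProduct.induction_on with
  | zero => simp
  | tmul a v => simp [autV_tmul]
  | add x y hx hy => simp [hx, hy]

lemma autV_symm (x : ℂ ⊗[ℚ] V) : autV V E.symm (autV V E x) = x := by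
  induction x using TensorProduct.induction_on with
  | zero => simp
  | tmul a v => simp [autV_tmul]
  | add x y hx hy => simp [hx, hy]

lemma conjV_eq : conjV V = autV V (starRingAut (R := ℂ)) := by
  ext x
  rfl

lemma rat_aut (f : DualVC V) (hf : isRatFunctional V f) (x : ℂ ⊗[ℚ] V) :
    f (autV V E x) = E (f x) := by
  induction x using TensorProduct.induction_on with
  | zero => simp
  | tmul a v =>
    obtain ⟨r, hr⟩ := hf v
    have h : ∀ a : ℂ, a ⊗ₜ[ℚ] v = a • iotaV V v := fun a => by
      simp [iotaV, TensorProduct.smul_tmul']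
    rw [autV_tmul, h, h, map_smul, map_smul, hr]
    simp
  | add x y hx hy => simp [hx, hy]

variable {m : ℕ} {lam : Fin m → ℂ} {φ : V →ₗ[ℚ] V} {e : Module.Basis (Fin m) ℂ (ℂ ⊗[ℚ] V)}

lemma phi_coord (heig : ∀ i, LinearMap.baseChange ℂ φ (e i) = lam i • e i) (x : ℂ ⊗[ℚ] V)
    (i : Fin m) : e.coord i (LinearMap.baseChange ℂ φ x) = lam i * e.coord i x := by
  have : (e.coord i) ∘ₗ (LinearMap.baseChange ℂ φ) = lam i • e.coord i := by
    refine e.ext fun j => ?_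
    simp only [LinearMap.comp_apply, heig, map_smul, LinearMap.smul_apply, Module.Basis.coord_apply,
      Module.Basis.repr_self, Finsupp.single_apply, smul_eq_mul]
    split_ifs with h
    · rw [h]
    · simp
  exact LinearMap.congr_fun this x

lemma eig_unique (hinj : Function.Injective lam)
    (heig : ∀ i, LinearMap.baseChange ℂ φ (e i) = lam i • e i) (j : Fin m) (x : ℂ ⊗[ℚ] V)
    (hx : LinearMap.baseChange ℂ φ x = lam j • x) : x = e.coord j x • e j := by
  refine e.ext_elem fun i => ?_
  have h := phi_coord heig x i
  rw [hx, map_smul, smul_eq_mul] at h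
  simp only [map_smul, Module.Basis.repr_self, Finsupp.smul_apply, Finsupp.single_apply,
    smul_eq_mul]
  simp only [Module.Basis.coord_apply] at h ⊢
  split_ifs with hij
  · rw [hij]; simp
  · have : lam j ≠ lam i := fun h => hij (hinj h)
    have h2 : (lam j - lam i) * e.repr x i = 0 := by rw [sub_mul, h, sub_self]
    simpa [sub_eq_zero, this] using h2

lemma aut_eig (hinj : Function.Injective lam)
    (heig : ∀ i, LinearMap.baseChange ℂ φ (e i) = lam i • e i) {i j : Fin m}
    (hE : E (lam i) = lam j) : ∃ c : ℂ, c ≠ 0 ∧ autV V E (e i) = c • e j := by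
  have h := eig_unique hinj heig j (autV V E (e i)) (by rw [autV_phi, heig, autV_smul, hE])
  refine ⟨_, fun h0 => ?_, h⟩
  rw [h0, zero_smul] at h
  have h2 := autV_symm E (e i)
  rw [h, map_zero] at h2
  exact e.ne_zero i h2.symm

variable {E} {τ : Equiv.Perm (Fin m)} {c : Fin m → ℂ}

lemma coord_aut (hS : ∀ i, autV V E (e i) = c i • e (τ i)) (v : V)
    (i : Fin m) : e.coord (τ i) (iotaV V v) = c i * E (e.coord i (iotaV V v)) := by
  have h := e.sum_repr (iotaV V v)
  have h2 := congrArg (autV V E) h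
  rw [autV_iota, map_sum] at h2
  conv_lhs => rw [← h2]
  simp only [autV_smul, hS, map_sum, map_smul, Module.Basis.coord_apply, Module.Basis.repr_self,
    Finsupp.single_apply, smul_eq_mul, EmbeddingLike.apply_eq_iff_eq]
  simp [mul_comm]

/-- The coordinate of `e_i^* ∧ e_j^* ⊗ e_k ∧ e_l`. -/
def coefA (e : Module.Basis (Fin m) ℂ (ℂ ⊗[ℚ] V)) (i j k l : Fin m) :
    ExtD V ⊗[ℂ] ExtC V →ₗ[ℂ] ℂ :=
  LinearMap.mul' ℂ ℂ ∘ₗ TensorProduct.map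
    (wedgePair (Module.Dual.eval ℂ _ (e i)) (Module.Dual.eval ℂ _ (e j)))
    (wedgePair (e.coord k) (e.coord l))

lemma coefA_tmul (i j k l : Fin m) (d : ExtD V) (b : ExtC V) :
    coefA e i j k l (d ⊗ₜ b) =
      wedgePair (Module.Dual.eval ℂ _ (e i)) (Module.Dual.eval ℂ _ (e j)) d *
      wedgePair (e.coord k) (e.coord l) b := rfl

lemma thetaA_iota [Algebra ℚ (ExtC V)] [IsScalarTower ℚ ℂ (ExtC V)] (v : V) :
    thetaA V (ExteriorAlgebra.ι ℚ v) = ExteriorAlgebra.ι ℂ (iotaV V v) :=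
  ExteriorAlgebra.lift_ι_apply ℚ _ _ v

lemma thetaA_iMulti [Algebra ℚ (ExtC V)] [IsScalarTower ℚ ℂ (ExtC V)] (v : Fin 2 → V) :
    thetaA V (ExteriorAlgebra.ιMulti ℚ 2 v) =
      ExteriorAlgebra.ιMulti ℂ 2 (fun i => iotaV V (v i)) := by
  rw [iMulti_two, iMulti_two_rat, map_mul, thetaA_iota, thetaA_iota]

lemma thetaA_smul_s11 [Algebra ℚ (ExtC V)] [IsScalarTower ℚ ℂ (ExtC V)] (a : ℚ)
    (x : ExteriorAlgebra ℚ V) : thetaA V (a • x) = (a : ℂ) • thetaA V x := by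
  rw [Algebra.smul_def, map_mul, AlgHom.commutes, IsScalarTower.algebraMap_apply ℚ ℂ (ExtC V),
    Algebra.smul_def]
  rfl

lemma theta_aut [Algebra ℚ (ExtC V)] [IsScalarTower ℚ ℂ (ExtC V)]
    (hS : ∀ i, autV V E (e i) = c i • e (τ i)) (b : ExteriorAlgebra ℚ V) (hb : b ∈ ⋀[ℚ]^2 V)
    (k l : Fin m) :
    wedgePair (e.coord (τ k)) (e.coord (τ l)) (thetaA V b) =
      c k * c l * E (wedgePair (e.coord k) (e.coord l) (thetaA V b)) := by
  rw [← ExteriorAlgebra.ιMulti_span_fixedDegree] at hb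
  induction hb using Submodule.span_induction with
  | mem x h =>
    obtain ⟨v, rfl⟩ := h
    rw [thetaA_iMulti, wedgePair_apply, wedgePair_apply]
    simp only [coord_aut hS, map_sub, map_mul]
    ring
  | zero => simp
  | add x y _ _ hx hy => simp only [map_add, hx, hy, mul_add]
  | smul a x _ hx =>
    rw [thetaA_smul_s11, map_smul, map_smul, hx]
    simp only [smul_eq_mul, map_mul, map_ratCast]
    ring

lemma dual_aut [Module ℚ (ExtD V)] [IsScalarTower ℚ ℂ (ExtD V)] (hc : ∀ i, c i ≠ 0)
    (hS : ∀ i, autV V E (e i) = c i • e (τ i)) (d : ExtD V) (hd : d ∈ ratDual2 V)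
    (i j : Fin m) :
    wedgePair (Module.Dual.eval ℂ _ (e (τ i))) (Module.Dual.eval ℂ _ (e (τ j))) d =
      (c i)⁻¹ * (c j)⁻¹ *
        E (wedgePair (Module.Dual.eval ℂ _ (e i)) (Module.Dual.eval ℂ _ (e j)) d) := by
  unfold ratDual2 at hd
  induction hd using Submodule.span_induction with
  | mem x h =>
    obtain ⟨fg, hfg, rfl⟩ := h
    have key : ∀ a i, fg a (e (τ i)) = (c i)⁻¹ * E (fg a (e i)) := fun a i => by
      rw [← rat_aut E _ (hfg a), hS, map_smul, smul_eq_mul, inv_mul_cancel_left₀ (hc i)]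
    rw [wedgePair_apply, wedgePair_apply]
    simp only [Module.Dual.eval_apply, key, map_sub, map_mul]
    ring
  | zero => simp
  | add x y _ _ hx hy => simp only [map_add, hx, hy, mul_add]
  | smul a x _ hx =>
    rw [rat_smul_eq, map_smul, map_smul, hx]
    simp only [smul_eq_mul, map_mul, map_ratCast]
    ring

lemma coefA_aut [Algebra ℚ (ExtC V)] [IsScalarTower ℚ ℂ (ExtC V)]
    [Module ℚ (ExtD V)] [IsScalarTower ℚ ℂ (ExtD V)]
    [Module ℚ (ExtD V ⊗[ℂ] ExtC V)] [IsScalarTower ℚ ℂ (ExtD V ⊗[ℂ] ExtC V)]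
    (hc : ∀ i, c i ≠ 0)
    (hS : ∀ i, autV V E (e i) = c i • e (τ i)) (t : ExtD V ⊗[ℂ] ExtC V) (ht : t ∈ ratTensor11 V)
    (i j k l : Fin m) :
    coefA e (τ i) (τ j) (τ k) (τ l) t =
      (c i)⁻¹ * (c j)⁻¹ * (c k * c l) * E (coefA e i j k l t) := by
  unfold ratTensor11 at ht
  induction ht using Submodule.span_induction with
  | mem x h =>
    obtain ⟨d, b, hd, hb, rfl⟩ := h
    rw [coefA_tmul, coefA_tmul, theta_aut hS b hb, dual_aut hc hS d hd, map_mul]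
    ring
  | zero => simp
  | add x y _ _ hx hy => simp only [map_add, hx, hy, mul_add]
  | smul a x _ hx =>
    rw [rat_smul_eq, map_smul, map_smul, hx]
    simp only [smul_eq_mul, map_mul, map_ratCast]
    ring

/-- The span of pure wedges in `⋀²V*_ℂ ⊗ ⋀²V_ℂ`. -/
lemma rat_recon [Algebra ℚ (ExtC V)] [IsScalarTower ℚ ℂ (ExtC V)]
    [Module ℚ (ExtD V)] [IsScalarTower ℚ ℂ (ExtD V)]
    [Module ℚ (ExtD V ⊗[ℂ] ExtC V)] [IsScalarTower ℚ ℂ (ExtD V ⊗[ℂ] ExtC V)]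
    (e : Module.Basis (Fin m) ℂ (ℂ ⊗[ℚ] V))
    (t : ExtD V ⊗[ℂ] ExtC V) (ht : t ∈ ratTensor11 V) :
    t = ∑ i, ∑ j, ∑ k, ∑ l, ((1 / 4 : ℂ) * coefA e i j k l t) •
      ((ExteriorAlgebra.ιMulti ℂ 2 ![e.dualBasis i, e.dualBasis j]) ⊗ₜ[ℂ]
        (ExteriorAlgebra.ιMulti ℂ 2 ![e k, e l])) := by
  have hdc : ∀ i, e.dualBasis.coord i = Module.Dual.eval ℂ _ (e i) := fun i => by
    ext f; simp
  unfold ratTensor11 at ht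
  induction ht using Submodule.span_induction with
  | mem x h =>
    obtain ⟨d, b, hd, hb, rfl⟩ := h
    have hd2 : d ∈ ⋀[ℂ]^2 (DualVC V) := by
      unfold ratDual2 at hd
      induction hd using Submodule.span_induction with
      | mem x h =>
        obtain ⟨fg, -, rfl⟩ := h
        rw [← ExteriorAlgebra.ιMulti_span_fixedDegree]
        exact Submodule.subset_span ⟨_, rfl⟩
      | zero => exact Submodule.zero_mem _
      | add x y _ _ hx hy => exact Submodule.add_mem _ hx hy
      | smul a x _ hx => rw [rat_smul_eq]; exact Submodule.smul_mem _ _ hx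
    have hb2 : thetaA V b ∈ ⋀[ℂ]^2 (ℂ ⊗[ℚ] V) := by
      rw [← ExteriorAlgebra.ιMulti_span_fixedDegree] at hb
      induction hb using Submodule.span_induction with
      | mem x h =>
        obtain ⟨v, rfl⟩ := h
        rw [← ExteriorAlgebra.ιMulti_span_fixedDegree, thetaA_iMulti]
        exact Submodule.subset_span ⟨_, rfl⟩
      | zero => rw [map_zero]; exact Submodule.zero_mem _
      | add x y _ _ hx hy => rw [map_add]; exact Submodule.add_mem _ hx hy
      | smul a x _ hx => rw [thetaA_smul_s11]; exact Submodule.smul_mem _ _ hx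
    simp only [coefA_tmul]
    conv_lhs => rw [wedge_recon e.dualBasis d hd2, wedge_recon e _ hb2]
    simp only [hdc, TensorProduct.sum_tmul]
    simp only [TensorProduct.tmul_sum, TensorProduct.smul_tmul_smul]
    refine Finset.sum_congr rfl fun i _ => Finset.sum_congr rfl fun j _ =>
      Finset.sum_congr rfl fun k _ => Finset.sum_congr rfl fun l _ => ?_
    congr 1
    ring
  | zero => simp
  | add x y _ _ hx hy =>
    conv_lhs => rw [hx, hy]
    simp only [map_add, mul_add, add_smul, Finset.sum_add_distrib]
  | smul a x _ hx =>
    rw [rat_smul_eq]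
    conv_lhs => rw [hx]
    simp only [map_smul, Finset.smul_sum, smul_smul, smul_eq_mul]
    refine Finset.sum_congr rfl fun i _ => Finset.sum_congr rfl fun j _ =>
      Finset.sum_congr rfl fun k _ => Finset.sum_congr rfl fun l _ => ?_
    congr 1; ring

end aut

lemma exists_coef_ne {M : Type} [AddCommGroup M] [Module ℂ M] {m : ℕ}
    (b : Module.Basis (Fin m) ℂ M) (x : ExteriorAlgebra ℂ M) (hx : x ∈ ⋀[ℂ]^2 M) (h0 : x ≠ 0) :
    ∃ i j, i ≠ j ∧ wedgePair (b.coord i) (b.coord j) x ≠ 0 := by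
  by_contra! hcon
  apply h0
  rw [wedge_recon b x hx]
  refine Finset.sum_eq_zero fun i _ => Finset.sum_eq_zero fun j _ => ?_
  by_cases hij : i = j
  · rw [hij, iMulti_self, smul_zero]
  · rw [hcon i j hij, mul_zero, zero_smul]

lemma eq_smul_of_support {M : Type} [AddCommGroup M] [Module ℂ M] {m : ℕ}
    (b : Module.Basis (Fin m) ℂ M) (x : ExteriorAlgebra ℂ M) (hx : x ∈ ⋀[ℂ]^2 M) (k l : Fin m)
    (h : ∀ i j, i ≠ j → wedgePair (b.coord i) (b.coord j) x ≠ 0 →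
      (i = k ∧ j = l) ∨ (i = l ∧ j = k)) :
    ∃ z : ℂ, x = z • ExteriorAlgebra.ιMulti ℂ 2 ![b k, b l] := by
  suffices x ∈ Submodule.span ℂ {ExteriorAlgebra.ιMulti ℂ 2 ![b k, b l]} by
    obtain ⟨z, hz⟩ := Submodule.mem_span_singleton.1 this
    exact ⟨z, hz.symm⟩
  rw [wedge_recon b x hx]
  refine Submodule.sum_mem _ fun i _ => Submodule.sum_mem _ fun j _ => ?_
  by_cases hij : i = j
  · rw [hij, iMulti_self, smul_zero]; exact Submodule.zero_mem _
  by_cases hc : wedgePair (b.coord i) (b.coord j) x = 0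
  · rw [hc, mul_zero, zero_smul]; exact Submodule.zero_mem _
  apply Submodule.smul_mem
  rcases h i j hij hc with ⟨rfl, rfl⟩ | ⟨rfl, rfl⟩
  · exact Submodule.mem_span_singleton_self _
  · rw [iMulti_swap (b j) (b i)]
    apply Submodule.neg_mem
    exact Submodule.mem_span_singleton_self _

section main
variable {V : Type} [AddCommGroup V] [Module ℚ V] {m : ℕ}
  (e : Module.Basis (Fin m) ℂ (ℂ ⊗[ℚ] V))

lemma std_swap (i j : Fin m) : stdHodgeElt V e i j = stdHodgeElt V e j i := by
  unfold stdHodgeElt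
  rw [iMulti_swap (e.dualBasis j), iMulti_swap (e j), TensorProduct.neg_tmul,
    TensorProduct.tmul_neg, neg_neg]

lemma std_self (i : Fin m) : stdHodgeElt V e i i = 0 := by
  unfold stdHodgeElt
  rw [iMulti_self, TensorProduct.zero_tmul]

lemma std_mem (i j : Fin m) : stdHodgeElt V e i j ∈ Submodule.span ℂ {t : ExtD V ⊗[ℂ] ExtC V |
    ∃ i j : Fin m, (i : ℕ) < (j : ℕ) ∧ t = stdHodgeElt V e i j} := by
  rcases lt_trichotomy (i : ℕ) j with h | h | h
  · exact Submodule.subset_span ⟨i, j, h, rfl⟩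
  · rw [Fin.ext h, std_self]; exact Submodule.zero_mem _
  · rw [std_swap]; exact Submodule.subset_span ⟨j, i, h, rfl⟩

lemma coefA_std (a b i j k l : Fin m) (h : (k ≠ i ∧ k ≠ j) ∨ (l ≠ i ∧ l ≠ j)) :
    coefA e i j k l (stdHodgeElt V e a b) = 0 := by
  rw [stdHodgeElt, coefA_tmul, wedgePair_apply, wedgePair_apply]
  simp only [Module.Dual.eval_apply, Module.Basis.dualBasis_apply, Module.Basis.coord_apply,
    Matrix.cons_val_zero, Matrix.cons_val_one, Module.Basis.repr_self, Finsupp.single_apply]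
  by_cases h1 : (i = a ∧ j = b) ∨ (i = b ∧ j = a)
  · apply mul_eq_zero_of_right
    split_ifs <;> grind
  · apply mul_eq_zero_of_left
    split_ifs <;> grind

variable {W : Submodule ℂ (ℂ ⊗[ℚ] V)} {n : ℕ}

lemma coord_W {e : Module.Basis (Fin m) ℂ (ℂ ⊗[ℚ] V)}
    (hWe : W = Submodule.span ℂ (e '' {i : Fin m | (i : ℕ) < n})) (k : Fin m)
    (hk : n ≤ (k : ℕ)) (x : ℂ ⊗[ℚ] V) (hx : x ∈ W) : e.coord k x = 0 := by
  rw [hWe] at hx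
  induction hx using Submodule.span_induction with
  | mem x h =>
    obtain ⟨i, hi, rfl⟩ := h
    have hi : (i : ℕ) < n := hi
    have : i ≠ k := fun h => by rw [h] at hi; omega
    simp [Finsupp.single_apply, this]
  | zero => simp
  | add x y _ _ hx hy => rw [map_add, hx, hy, add_zero]
  | smul a x _ hx => rw [map_smul, hx, smul_zero]

lemma hodge_vanish {e : Module.Basis (Fin m) ℂ (ℂ ⊗[ℚ] V)}
    (hWe : W = Submodule.span ℂ (e '' {i : Fin m | (i : ℕ) < n}))
    (t : ExtD V ⊗[ℂ] ExtC V) (ht : t ∈ hodge22Tensor11 V W) (i j k l : Fin m)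
    (hi : (i : ℕ) < n) (hj : (j : ℕ) < n) (hkl : n ≤ (k : ℕ) ∨ n ≤ (l : ℕ)) :
    coefA e i j k l t = 0 := by
  have heW : ∀ i : Fin m, (i : ℕ) < n → e i ∈ W := fun i hi => by
    rw [hWe]; exact Submodule.subset_span ⟨i, hi, rfl⟩
  unfold hodge22Tensor11 at ht
  induction ht using Submodule.span_induction with
  | zero => simp
  | add x y _ _ hx hy => rw [map_add, hx, hy, add_zero]
  | smul a x _ hx => rw [map_smul, hx, smul_zero]
  | mem x h =>
    obtain ⟨p₁, p₂, h1, h2, h12, d, b, hd, hb, rfl⟩ := h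
    rw [coefA_tmul]
    rcases Nat.eq_zero_or_pos p₁ with h0 | h0
    · have hp2 : p₂ = 2 := by omega
      subst hp2
      apply mul_eq_zero_of_right
      unfold hodgeComp at hb
      induction hb using Submodule.span_induction with
      | zero => simp
      | add x y _ _ hx hy => rw [map_add, hx, hy, add_zero]
      | smul a x _ hx => rw [map_smul, hx, smul_zero]
      | mem x h =>
        obtain ⟨v, hv, rfl⟩ := h
        have hv0 := (hv 0).1 (by simp)
        have hv1 := (hv 1).1 (by simp)
        rw [wedgePair_apply]
        rcases hkl with hk | hl
        · rw [coord_W hWe k hk _ hv0, coord_W hWe k hk _ hv1]; ring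
        · rw [coord_W hWe l hl _ hv0, coord_W hWe l hl _ hv1]; ring
    · apply mul_eq_zero_of_left
      unfold dualHodgeComp at hd
      induction hd using Submodule.span_induction with
      | zero => simp
      | add x y _ _ hx hy => rw [map_add, hx, hy, add_zero]
      | smul a x _ hx => rw [map_smul, hx, smul_zero]
      | mem x h =>
        obtain ⟨fg, hfg, rfl⟩ := h
        have hf := (hfg 0).1 (by simpa using h0)
        rw [wedgePair_apply, Module.Dual.eval_apply, Module.Dual.eval_apply,
          Module.Dual.eval_apply, Module.Dual.eval_apply, hf _ (heW i hi), hf _ (heW j hj)]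
        ring

lemma exists_perm_s11 (hn : 2 ≤ n) (i j k : Fin (2 * n)) (hij : i ≠ j) (hik : k ≠ i) (hjk : k ≠ j) :
    ∃ τ : Equiv.Perm (Fin (2 * n)), (τ i : ℕ) < n ∧ (τ j : ℕ) < n ∧ n ≤ (τ k : ℕ) := by
  have h3 := Equiv.Perm.isMultiplyPretransitive (Fin (2 * n)) 3
  let x : Fin 3 ↪ Fin (2 * n) := ⟨![i, j, k], by
    intro a b h; fin_cases a <;> fin_cases b <;> simp_all⟩
  let y : Fin 3 ↪ Fin (2 * n) := ⟨![⟨0, by omega⟩, ⟨1, by omega⟩, ⟨n, by omega⟩], by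
    intro a b h; fin_cases a <;> fin_cases b <;> simp_all <;> omega⟩
  obtain ⟨τ, hτ⟩ := h3.exists_smul_eq x y
  have e0 : τ i = ⟨0, by omega⟩ := DFunLike.congr_fun hτ 0
  have e1 : τ j = ⟨1, by omega⟩ := DFunLike.congr_fun hτ 1
  have e2 : τ k = ⟨n, by omega⟩ := DFunLike.congr_fun hτ 2
  refine ⟨τ, ?_, ?_, ?_⟩
  · rw [e0]; simp; omega
  · rw [e1]; simp; omega
  · rw [e2]

lemma conj_coord {φ : V →ₗ[ℚ] V} {lam : Fin m → ℂ} (hinj : Function.Injective lam)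
    {e : Module.Basis (Fin m) ℂ (ℂ ⊗[ℚ] V)}
    (heig : ∀ i, LinearMap.baseChange ℂ φ (e i) = lam i • e i)
    (hWinf : W.restrictScalars ℚ ⊓ conjSub V W = ⊥)
    (hWe : W = Submodule.span ℂ (e '' {i : Fin m | (i : ℕ) < n}))
    (k : Fin m) (hk : (k : ℕ) < n) (y : ℂ ⊗[ℚ] V) (hy : y ∈ conjSub V W) :
    e.coord k y = 0 := by
  have heW : ∀ i : Fin m, (i : ℕ) < n → e i ∈ W := fun i hi => by
    rw [hWe]; exact Submodule.subset_span ⟨i, hi, rfl⟩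
  obtain ⟨w, hw, rfl⟩ := hy
  replace hw : w ∈ W := hw
  rw [conjV_eq]
  replace hw : w ∈ Submodule.span ℂ (e '' {i : Fin m | (i : ℕ) < n}) := by
    rw [← hWe]; exact hw
  induction hw using Submodule.span_induction with
  | zero => simp
  | add x y _ _ hx hy => rw [map_add, map_add, hx, hy, add_zero]
  | smul a x _ hx => rw [autV_smul, map_smul, hx, smul_zero]
  | mem x h =>
    obtain ⟨i, hi, rfl⟩ := h
    by_contra hne
    have h1 := phi_coord heig (autV V starRingAut (e i)) k
    rw [autV_phi, heig, autV_smul, map_smul, smul_eq_mul] at h1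
    have h2 := mul_right_cancel₀ hne h1
    obtain ⟨c, hc, hce⟩ := aut_eig (starRingAut (R := ℂ)) hinj heig h2
    have hmem : autV V starRingAut (e i) ∈ W.restrictScalars ℚ ⊓ conjSub V W := by
      refine ⟨?_, ⟨e i, heW i hi, by rw [conjV_eq]⟩⟩
      rw [hce]
      exact W.smul_mem _ (heW k hk)
    rw [hWinf, Submodule.mem_bot] at hmem
    rw [hmem, map_zero] at hne
    exact hne rfl

lemma e_mem_conj {φ : V →ₗ[ℚ] V} {lam : Fin m → ℂ} (hinj : Function.Injective lam)
    {e : Module.Basis (Fin m) ℂ (ℂ ⊗[ℚ] V)}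
    (heig : ∀ i, LinearMap.baseChange ℂ φ (e i) = lam i • e i)
    (hWsup : W.restrictScalars ℚ ⊔ conjSub V W = ⊤)
    (hWinf : W.restrictScalars ℚ ⊓ conjSub V W = ⊥)
    (hWe : W = Submodule.span ℂ (e '' {i : Fin m | (i : ℕ) < n}))
    (k : Fin m) (hk : n ≤ (k : ℕ)) : e k ∈ conjSub V W := by
  have h : e k ∈ W.restrictScalars ℚ ⊔ conjSub V W := by rw [hWsup]; trivial
  obtain ⟨w, hw, y, hy, hwy⟩ := Submodule.mem_sup.1 h
  have hw0 : w = 0 := by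
    refine e.ext_elem fun i => ?_
    rw [map_zero, Finsupp.zero_apply, ← Module.Basis.coord_apply]
    rcases lt_or_ge (i : ℕ) n with hi | hi
    · have : w = e k - y := by rw [← hwy]; simp
      rw [this, map_sub, conj_coord hinj heig hWinf hWe i hi y hy, sub_zero]
      have : k ≠ i := fun h => by rw [h] at hk; omega
      simp [Finsupp.single_apply, this]
    · exact coord_W hWe i hi w hw
  rw [hw0, zero_add] at hwy
  rw [← hwy]; exact hy

lemma std_hodge {φ : V →ₗ[ℚ] V} {lam : Fin m → ℂ} (hinj : Function.Injective lam)
    {e : Module.Basis (Fin m) ℂ (ℂ ⊗[ℚ] V)}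
    (heig : ∀ i, LinearMap.baseChange ℂ φ (e i) = lam i • e i)
    (hWsup : W.restrictScalars ℚ ⊔ conjSub V W = ⊤)
    (hWinf : W.restrictScalars ℚ ⊓ conjSub V W = ⊥)
    (hWe : W = Submodule.span ℂ (e '' {i : Fin m | (i : ℕ) < n})) (i j : Fin m)
    (hij : (i : ℕ) < j) :
    stdHodgeElt V e i j ∈ hodge22Tensor11 V W := by
  have heW : ∀ i : Fin m, (i : ℕ) < n → e i ∈ W := fun i hi => by
    rw [hWe]; exact Submodule.subset_span ⟨i, hi, rfl⟩
  have hcW := e_mem_conj hinj heig hWsup hWinf hWe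
  have hdW : ∀ k : Fin m, n ≤ (k : ℕ) → ∀ y ∈ W, e.dualBasis k y = 0 := fun k hk y hy => by
    rw [Module.Basis.dualBasis_apply]; exact coord_W hWe k hk y hy
  have hdc : ∀ k : Fin m, (k : ℕ) < n → ∀ y ∈ conjSub V W, e.dualBasis k y = 0 :=
    fun k hk y hy => by
      rw [Module.Basis.dualBasis_apply]; exact conj_coord hinj heig hWinf hWe k hk y hy
  unfold stdHodgeElt
  rcases lt_or_ge (j : ℕ) n with hj | hj
  · have hi : (i : ℕ) < n := by omega
    refine Submodule.subset_span ⟨0, 2, by omega, by omega, by omega, _, _,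
      Submodule.subset_span ⟨_, ?_, rfl⟩, Submodule.subset_span ⟨_, ?_, rfl⟩, rfl⟩
    · intro a
      refine ⟨fun h => by omega, fun _ => ?_⟩
      fin_cases a
      · exact hdc i hi
      · exact hdc j hj
    · intro a
      refine ⟨fun _ => ?_, fun h => by omega⟩
      fin_cases a
      · exact heW i hi
      · exact heW j hj
  rcases lt_or_ge (i : ℕ) n with hi | hi
  · rw [iMulti_swap (e.dualBasis j), TensorProduct.neg_tmul]
    refine Submodule.neg_mem _ ?_
    refine Submodule.subset_span ⟨1, 1, by omega, by omega, by omega, _, _,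
      Submodule.subset_span ⟨_, ?_, rfl⟩, Submodule.subset_span ⟨_, ?_, rfl⟩, rfl⟩
    · intro a
      fin_cases a
      · exact ⟨fun _ => hdW j hj, fun h => by simp at h⟩
      · exact ⟨fun h => by simp at h, fun _ => hdc i hi⟩
    · intro a
      fin_cases a
      · exact ⟨fun _ => heW i hi, fun h => by simp at h⟩
      · exact ⟨fun h => by simp at h, fun _ => hcW j hj⟩
  · refine Submodule.subset_span ⟨2, 0, by omega, by omega, by omega, _, _,
      Submodule.subset_span ⟨_, ?_, rfl⟩, Submodule.subset_span ⟨_, ?_, rfl⟩, rfl⟩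
    · intro a
      refine ⟨fun _ => ?_, fun h => by omega⟩
      fin_cases a
      · exact hdW i hi
      · exact hdW j hj
    · intro a
      refine ⟨fun h => by omega, fun _ => ?_⟩
      fin_cases a
      · exact hcW i hi
      · exact hcW j hj

lemma basis_indep {M N : Type} [AddCommGroup M] [Module ℂ M] [AddCommGroup N] [Module ℂ N]
    {ι κ : Type} [Fintype ι] [Fintype κ] [DecidableEq ι] [DecidableEq κ]
    (u : Module.Basis ι ℂ M) (e : Module.Basis κ ℂ M) (A : M →ₗ[ℂ] M)
    (B : Module.Dual ℂ M →ₗ[ℂ] M →ₗ[ℂ] N) :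
    ∑ a, B (u.dualBasis a) (A (u a)) = ∑ i, B (e.dualBasis i) (A (e i)) := by
  have h1 : ∀ a, B (u.dualBasis a) (A (u a)) =
      ∑ i, e.coord i (u a) • B (u.dualBasis a) (A (e i)) := fun a => by
    conv_lhs => rw [← e.sum_repr (u a)]
    simp only [map_sum, map_smul, Module.Basis.coord_apply]
  have h2 : ∀ i, B (e.dualBasis i) (A (e i)) =
      ∑ a, e.coord i (u a) • B (u.dualBasis a) (A (e i)) := fun i => by
    conv_lhs => rw [← u.dualBasis.sum_repr (e.dualBasis i)]
    simp only [map_sum, map_smul, LinearMap.sum_apply, LinearMap.smul_apply,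
      Module.Basis.coord_apply, Module.Basis.dualBasis_repr, Module.Basis.dualBasis_apply]
  simp only [h1, h2]
  exact Finset.sum_comm

/-- The basis independent form of the rational classes attached to powers of `φ`. -/
lemma double_indep {ι : Type} [Fintype ι] [DecidableEq ι]
    (u : Module.Basis ι ℂ (ℂ ⊗[ℚ] V)) (A B : ℂ ⊗[ℚ] V →ₗ[ℂ] ℂ ⊗[ℚ] V) :
    ∑ a, ∑ b, (ExteriorAlgebra.ιMulti ℂ 2 ![u.dualBasis a, u.dualBasis b]) ⊗ₜ[ℂ]
      (ExteriorAlgebra.ιMulti ℂ 2 ![A (u a), B (u b)]) =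
    ∑ i, ∑ j, (ExteriorAlgebra.ιMulti ℂ 2 ![e.dualBasis i, e.dualBasis j]) ⊗ₜ[ℂ]
      (ExteriorAlgebra.ιMulti ℂ 2 ![A (e i), B (e j)]) := by
  let T1 : DualVC V → ℂ ⊗[ℚ] V → (DualVC V →ₗ[ℂ] ℂ ⊗[ℚ] V →ₗ[ℂ] ExtD V ⊗[ℂ] ExtC V) :=
    fun f x => (TensorProduct.mk ℂ (ExtD V) (ExtC V)).compl₁₂
      (LinearMap.mulLeft ℂ (ExteriorAlgebra.ι ℂ f) ∘ₗ ExteriorAlgebra.ι ℂ)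
      (LinearMap.mulLeft ℂ (ExteriorAlgebra.ι ℂ x) ∘ₗ ExteriorAlgebra.ι ℂ)
  let T2 : DualVC V → ℂ ⊗[ℚ] V → (DualVC V →ₗ[ℂ] ℂ ⊗[ℚ] V →ₗ[ℂ] ExtD V ⊗[ℂ] ExtC V) :=
    fun f x => (TensorProduct.mk ℂ (ExtD V) (ExtC V)).compl₁₂
      (LinearMap.mulRight ℂ (ExteriorAlgebra.ι ℂ f) ∘ₗ ExteriorAlgebra.ι ℂ)
      (LinearMap.mulRight ℂ (ExteriorAlgebra.ι ℂ x) ∘ₗ ExteriorAlgebra.ι ℂ)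
  have hT1 : ∀ f x g y, T1 f x g y = (ExteriorAlgebra.ιMulti ℂ 2 ![f, g]) ⊗ₜ[ℂ]
      (ExteriorAlgebra.ιMulti ℂ 2 ![x, y]) := fun f x g y => by
    rw [iMulti_two, iMulti_two]; rfl
  have hT2 : ∀ f x g y, T2 g y f x = (ExteriorAlgebra.ιMulti ℂ 2 ![f, g]) ⊗ₜ[ℂ]
      (ExteriorAlgebra.ιMulti ℂ 2 ![x, y]) := fun f x g y => by
    rw [iMulti_two, iMulti_two]; rfl
  calc _ = ∑ a, ∑ j, (ExteriorAlgebra.ιMulti ℂ 2 ![u.dualBasis a, e.dualBasis j]) ⊗ₜ[ℂ]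
      (ExteriorAlgebra.ιMulti ℂ 2 ![A (u a), B (e j)]) := by
        refine Finset.sum_congr rfl fun a _ => ?_
        simp only [← hT1]
        exact basis_indep u e B _
    _ = ∑ j, ∑ a, (ExteriorAlgebra.ιMulti ℂ 2 ![u.dualBasis a, e.dualBasis j]) ⊗ₜ[ℂ]
      (ExteriorAlgebra.ιMulti ℂ 2 ![A (u a), B (e j)]) := Finset.sum_comm
    _ = ∑ j, ∑ i, (ExteriorAlgebra.ιMulti ℂ 2 ![e.dualBasis i, e.dualBasis j]) ⊗ₜ[ℂ]
      (ExteriorAlgebra.ιMulti ℂ 2 ![A (e i), B (e j)]) := by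
        refine Finset.sum_congr rfl fun a _ => ?_
        simp only [← hT2]
        exact basis_indep u e A _
    _ = _ := Finset.sum_comm

lemma pow_eig {φ : V →ₗ[ℚ] V} {lam : Fin m → ℂ} {e : Module.Basis (Fin m) ℂ (ℂ ⊗[ℚ] V)}
    (heig : ∀ i, LinearMap.baseChange ℂ φ (e i) = lam i • e i) (k : ℕ) (i : Fin m) :
    ((LinearMap.baseChange ℂ φ) ^ k) (e i) = lam i ^ k • e i := by
  induction k with
  | zero => simp
  | succ k ih =>
    rw [pow_succ', Module.End.mul_apply, ih, map_smul, heig, smul_smul, pow_succ]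

lemma pow_iota (φ : V →ₗ[ℚ] V) (k : ℕ) (v : V) :
    ((LinearMap.baseChange ℂ φ) ^ k) (iotaV V v) = iotaV V ((φ ^ k) v) := by
  induction k with
  | zero => simp
  | succ k ih =>
    rw [pow_succ', Module.End.mul_apply, ih, pow_succ', Module.End.mul_apply]
    simp [iotaV]

lemma power_rat [FiniteDimensional ℚ V] {φ : V →ₗ[ℚ] V} {lam : Fin m → ℂ}
    {e : Module.Basis (Fin m) ℂ (ℂ ⊗[ℚ] V)}
    (heig : ∀ i, LinearMap.baseChange ℂ φ (e i) = lam i • e i)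
    [Algebra ℚ (ExtC V)] [IsScalarTower ℚ ℂ (ExtC V)]
    [Module ℚ (ExtD V)] [IsScalarTower ℚ ℂ (ExtD V)]
    [Module ℚ (ExtD V ⊗[ℂ] ExtC V)] [IsScalarTower ℚ ℂ (ExtD V ⊗[ℂ] ExtC V)] (k l : ℕ) :
    ∑ i, ∑ j, (lam i ^ k * lam j ^ l) • stdHodgeElt V e i j ∈ ratTensor11 V := by
  let b := Module.finBasis ℚ V
  let u := b.baseChange ℂ
  have h := double_indep e u ((LinearMap.baseChange ℂ φ) ^ k) ((LinearMap.baseChange ℂ φ) ^ l)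
  have h2 : ∑ i, ∑ j, (lam i ^ k * lam j ^ l) • stdHodgeElt V e i j =
    ∑ i, ∑ j, (ExteriorAlgebra.ιMulti ℂ 2 ![e.dualBasis i, e.dualBasis j]) ⊗ₜ[ℂ]
      (ExteriorAlgebra.ιMulti ℂ 2 ![((LinearMap.baseChange ℂ φ) ^ k) (e i),
        ((LinearMap.baseChange ℂ φ) ^ l) (e j)]) := by
    refine Finset.sum_congr rfl fun i _ => Finset.sum_congr rfl fun j _ => ?_
    rw [pow_eig heig, pow_eig heig, stdHodgeElt, ← TensorProduct.tmul_smul]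
    congr 1
    simp only [iMulti_two, Matrix.cons_val_zero, Matrix.cons_val_one, map_smul,
      smul_mul_smul_comm]
  rw [h2, ← h]
  refine Submodule.sum_mem _ fun i _ => Submodule.sum_mem _ fun j _ => ?_
  have hrat : ∀ i, isRatFunctional V (u.dualBasis i) := fun i x => by
    refine ⟨b.repr x i, ?_⟩
    rw [Module.Basis.dualBasis_apply, iotaV, TensorProduct.mk_apply,
      Module.Basis.baseChange_repr_tmul, rat_smul_eq]
    simp
  have hu : ∀ i, u i = iotaV V (b i) := fun i => Module.Basis.baseChange_apply ℂ b i
  refine Submodule.subset_span ⟨ExteriorAlgebra.ιMulti ℂ 2 ![u.dualBasis i, u.dualBasis j],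
    ExteriorAlgebra.ιMulti ℚ 2 ![(φ ^ k) (b i), (φ ^ l) (b j)],
    Submodule.subset_span ⟨![u.dualBasis i, u.dualBasis j], ?_, rfl⟩, ?_, ?_⟩
  · intro a
    fin_cases a
    · exact hrat i
    · exact hrat j
  · rw [← ExteriorAlgebra.ιMulti_span_fixedDegree]
    exact Submodule.subset_span ⟨_, rfl⟩
  · rw [thetaA_iMulti]
    congr 1
    rw [iMulti_two, iMulti_two, hu, hu, pow_iota, pow_iota]
    rfl

open Polynomial in
lemma lagrange_mem {N : Type} [AddCommGroup N] [Module ℂ N] (S : Submodule ℂ N)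
    {lam : Fin m → ℂ} (hinj : Function.Injective lam) (s : Fin m → Fin m → N)
    (h : ∀ k l : ℕ, ∑ i, ∑ j, (lam i ^ k * lam j ^ l) • s i j ∈ S) (i j : Fin m) :
    s i j ∈ S := by
  have h1 : ∀ (P : ℂ[X]) (l : ℕ), ∑ i, ∑ j, (P.eval (lam i) * lam j ^ l) • s i j ∈ S := by
    intro P l
    induction P using Polynomial.induction_on' with
    | add p q hp hq =>
      simp only [eval_add, add_mul, add_smul, Finset.sum_add_distrib]
      exact S.add_mem hp hq
    | monomial k a =>
      simp only [eval_monomial, mul_assoc, mul_smul a, ← Finset.smul_sum]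
      exact S.smul_mem _ (h k l)
  have h2 : ∀ (P Q : ℂ[X]), ∑ i, ∑ j, (P.eval (lam i) * Q.eval (lam j)) • s i j ∈ S := by
    intro P Q
    induction Q using Polynomial.induction_on' with
    | add p q hp hq =>
      simp only [eval_add, mul_add, add_smul, Finset.sum_add_distrib]
      exact S.add_mem hp hq
    | monomial k a =>
      simp only [eval_monomial, mul_left_comm _ a, mul_smul a, ← Finset.smul_sum]
      exact S.smul_mem _ (h1 P k)
  have h3 := h2 (Lagrange.basis Finset.univ lam i) (Lagrange.basis Finset.univ lam j)
  have hb : ∀ i j, (Lagrange.basis Finset.univ lam i).eval (lam j) = if i = j then 1 else 0 := by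
    intro i j
    split_ifs with hij
    · rw [← hij]; exact Lagrange.eval_basis_self hinj.injOn (Finset.mem_univ _)
    · exact Lagrange.eval_basis_of_ne hij (Finset.mem_univ _)
  simpa [hb, ite_smul, Finset.sum_ite_eq] using h3

end main

/-- Under condition (*) (`n ≥ 4`), with `e₁, …, e_{2n}` a basis of `ℂ ⊗ V`
of eigenvectors of `φ_ℂ` ordered so that `W = span(e₁,…,e_n)`, the complexified space of Hodge
classes of `⋀²V* ⊗ ⋀²V` is the `ℂ`-span of the elements `e_i^* ∧ e_j^* ⊗ e_i ∧ e_j`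
(`i < j`), and every nonzero decomposable element of it is a scalar multiple of one of these;
in particular it contains, up to scalar, only finitely many elements of rank one. -/
theorem hodge_classes_span_and_rank_one
    (n : ℕ) (hn : 4 ≤ n)
    (V : Type) [AddCommGroup V] [Module ℚ V] [FiniteDimensional ℚ V]
    (hdim : Module.finrank ℚ V = 2 * n)
    (φ : V →ₗ[ℚ] V)
    (lam : Fin (2 * n) → ℂ) (hinj : Function.Injective lam)
    (hroot : ∀ i, Polynomial.aeval (lam i) (LinearMap.charpoly φ) = 0)
    (hgal : galoisActsFully (2 * n) lam)
    (W : Submodule ℂ (ℂ ⊗[ℚ] V))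
    (hWdim : Module.finrank ℂ W = n)
    (hWinv : ∀ x ∈ W, LinearMap.baseChange ℂ φ x ∈ W)
    (hWsup : W.restrictScalars ℚ ⊔ conjSub V W = ⊤)
    (hWinf : W.restrictScalars ℚ ⊓ conjSub V W = ⊥)
    [Algebra ℚ (ExtC V)] [IsScalarTower ℚ ℂ (ExtC V)]
    [Module ℚ (ExtD V)] [IsScalarTower ℚ ℂ (ExtD V)]
    [Module ℚ (ExtD V ⊗[ℂ] ExtC V)] [IsScalarTower ℚ ℂ (ExtD V ⊗[ℂ] ExtC V)]
    (e : Module.Basis (Fin (2 * n)) ℂ (ℂ ⊗[ℚ] V))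
    (heig : ∀ i, LinearMap.baseChange ℂ φ (e i) = lam i • e i)
    (hWe : W = Submodule.span ℂ (e '' {i : Fin (2 * n) | (i : ℕ) < n})) :
    Submodule.span ℂ ((hodgeClasses11 V W : Set (ExtD V ⊗[ℂ] ExtC V))) =
      Submodule.span ℂ {t : ExtD V ⊗[ℂ] ExtC V |
        ∃ i j : Fin (2 * n), (i : ℕ) < (j : ℕ) ∧ t = stdHodgeElt V e i j} ∧
    ∀ (α : ExtD V) (β : ExtC V), α ∈ ⋀[ℂ]^2 (DualVC V) → β ∈ ⋀[ℂ]^2 (ℂ ⊗[ℚ] V) →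
      α ⊗ₜ[ℂ] β ∈ Submodule.span ℂ ((hodgeClasses11 V W : Set (ExtD V ⊗[ℂ] ExtC V))) →
      α ⊗ₜ[ℂ] β ≠ 0 →
      ∃ i j : Fin (2 * n), (i : ℕ) < (j : ℕ) ∧
        ∃ z : ℂ, α ⊗ₜ[ℂ] β = z • stdHodgeElt V e i j := by
  have halg : ∀ i, IsAlgebraic ℚ (lam i) := fun i =>
    ⟨LinearMap.charpoly φ, (LinearMap.charpoly_monic φ).ne_zero, hroot i⟩
  have hspan : Submodule.span ℂ ((hodgeClasses11 V W : Set (ExtD V ⊗[ℂ] ExtC V))) =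
      Submodule.span ℂ {t : ExtD V ⊗[ℂ] ExtC V |
        ∃ i j : Fin (2 * n), (i : ℕ) < (j : ℕ) ∧ t = stdHodgeElt V e i j} := by
    apply le_antisymm
    · rw [Submodule.span_le]
      rintro t ⟨ht1, ht2⟩
      have ht2 : t ∈ hodge22Tensor11 V W := ht2
      have van : ∀ i j k l, i ≠ j → ((k ≠ i ∧ k ≠ j) ∨ (l ≠ i ∧ l ≠ j)) →
          coefA e i j k l t = 0 := by
        intro i j k l hij hkl
        have hτ : ∃ τ : Equiv.Perm (Fin (2 * n)), (τ i : ℕ) < n ∧ (τ j : ℕ) < n ∧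
            (n ≤ (τ k : ℕ) ∨ n ≤ (τ l : ℕ)) := by
          rcases hkl with ⟨h1, h2⟩ | ⟨h1, h2⟩
          · obtain ⟨τ, a, b, c⟩ := exists_perm_s11 (by omega) i j k hij h1 h2
            exact ⟨τ, a, b, Or.inl c⟩
          · obtain ⟨τ, a, b, c⟩ := exists_perm_s11 (by omega) i j l hij h1 h2
            exact ⟨τ, a, b, Or.inr c⟩
        obtain ⟨τ, hi, hj, hk⟩ := hτ
        obtain ⟨E, hE⟩ := exists_aut_of_gal lam halg hgal τ
        choose c hc hS using fun i => aut_eig E hinj heig (hE i)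
        have h1 := coefA_aut hc hS t ht1 i j k l
        rw [hodge_vanish hWe t ht2 _ _ _ _ hi hj hk] at h1
        have h2 : (c i)⁻¹ * (c j)⁻¹ * (c k * c l) ≠ 0 := by
          simp [hc]
        have h3 := (mul_eq_zero.1 h1.symm).resolve_left h2
        simpa using h3
      rw [rat_recon e t ht1]
      refine Submodule.sum_mem _ fun i _ => Submodule.sum_mem _ fun j _ =>
        Submodule.sum_mem _ fun k _ => Submodule.sum_mem _ fun l _ => ?_
      by_cases hij : i = j
      · rw [hij, iMulti_self, TensorProduct.zero_tmul, smul_zero]; exact Submodule.zero_mem _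
      by_cases hkl : k = l
      · rw [hkl, iMulti_self, TensorProduct.tmul_zero, smul_zero]; exact Submodule.zero_mem _
      by_cases hc : (k ≠ i ∧ k ≠ j) ∨ (l ≠ i ∧ l ≠ j)
      · rw [van i j k l hij hc, mul_zero, zero_smul]; exact Submodule.zero_mem _
      apply Submodule.smul_mem
      have hcase : (k = i ∧ l = j) ∨ (k = j ∧ l = i) := by grind
      rcases hcase with ⟨rfl, rfl⟩ | ⟨rfl, rfl⟩
      · exact std_mem e _ _
      · rw [iMulti_swap (e l), TensorProduct.tmul_neg]
        exact Submodule.neg_mem _ (std_mem e _ _)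
    · rw [Submodule.span_le]
      rintro t ⟨i, j, -, rfl⟩
      refine lagrange_mem _ hinj (fun i j => stdHodgeElt V e i j) (fun k l => ?_) i j
      refine Submodule.subset_span ⟨power_rat heig k l, ?_⟩
      change _ ∈ hodge22Tensor11 V W
      refine Submodule.sum_mem _ fun i _ => Submodule.sum_mem _ fun j _ =>
        Submodule.smul_mem _ _ ?_
      refine (Submodule.span_le.2 ?_) (std_mem e i j)
      rintro t ⟨i, j, hij, rfl⟩
      exact std_hodge hinj heig hWsup hWinf hWe i j hij
  refine ⟨hspan, fun α β hα hβ hmem hne => ?_⟩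
  rw [hspan] at hmem
  have hdc : ∀ i, e.dualBasis.coord i = Module.Dual.eval ℂ _ (e i) := fun i => by
    ext f; simp
  have van : ∀ i j k l, ((k ≠ i ∧ k ≠ j) ∨ (l ≠ i ∧ l ≠ j)) →
      wedgePair (e.dualBasis.coord i) (e.dualBasis.coord j) α *
        wedgePair (e.coord k) (e.coord l) β = 0 := by
    intro i j k l h
    rw [hdc, hdc, ← coefA_tmul]
    refine (Submodule.span_le (p := LinearMap.ker (coefA e i j k l))).2 ?_ hmem
    rintro t ⟨a, b, -, rfl⟩
    exact coefA_std e a b i j k l h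
  have hα0 : α ≠ 0 := fun h => hne (by rw [h, TensorProduct.zero_tmul])
  have hβ0 : β ≠ 0 := fun h => hne (by rw [h, TensorProduct.tmul_zero])
  obtain ⟨i, j, hij, hαij⟩ := exists_coef_ne e.dualBasis α hα hα0
  obtain ⟨k, l, hkl, hβkl⟩ := exists_coef_ne e β hβ hβ0
  have h1 : ¬ ((k ≠ i ∧ k ≠ j) ∨ (l ≠ i ∧ l ≠ j)) := fun h =>
    mul_ne_zero hαij hβkl (van i j k l h)
  obtain ⟨x, hx⟩ := eq_smul_of_support e.dualBasis α hα k l (fun a b hab hne' => by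
    have h2 : ¬ ((k ≠ a ∧ k ≠ b) ∨ (l ≠ a ∧ l ≠ b)) := fun h =>
      mul_ne_zero hne' hβkl (van a b k l h)
    grind)
  obtain ⟨y, hy⟩ := eq_smul_of_support e β hβ k l (fun a b hab hne' => by
    have h2 : ¬ ((a ≠ i ∧ a ≠ j) ∨ (b ≠ i ∧ b ≠ j)) := fun h =>
      mul_ne_zero hαij hne' (van i j a b h)
    grind)
  have hfin : α ⊗ₜ[ℂ] β = (x * y) • stdHodgeElt V e k l := by
    conv_lhs => rw [hx, hy]
    rw [TensorProduct.smul_tmul_smul]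
    rfl
  rcases lt_or_gt_of_ne (fun h => hkl (Fin.ext h) : (k : ℕ) ≠ l) with h | h
  · exact ⟨k, l, h, x * y, hfin⟩
  · exact ⟨l, k, h, x * y, by rw [hfin, std_swap]⟩

end VoisinPaper
end
end

section
/- (Deligne's Lemma, for the quadratic locus.) Let Z = {α ∈ B_ℂ : m_ℂ(α, α) = 0}, a Zariski-closed cone in B_ℂ. Let Z₁ ⊆ Z be a union of irreducible components of Z (for the Zariski topology on B_ℂ), and suppose that the ℂ-linear span of Z₁ equals ℂ ⊗ Q for some ℚ-subspace Q ⊆ B. Then Q is a rational sub-Hodge structure of B: ℂ ⊗ Q is the direct sum over p+q=k of its intersections with the subspaces B^{p,q}. -/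
open scoped TensorProduct

noncomputable section

namespace VoisinPaper

/-- Polynomial functions on a complex vector space: the subalgebra of functions generated by
the linear functionals. -/
def polyFunctions (X : Type) [AddCommGroup X] [Module ℂ X] : Subalgebra ℂ (X → ℂ) :=
  Algebra.adjoin ℂ {f : X → ℂ | ∃ l : X →ₗ[ℂ] ℂ, f = ⇑l}

/-- The Zariski-closed subsets of a complex vector space: common zero loci of families of
polynomial functions. -/
def zariskiClosedSets (X : Type) [AddCommGroup X] [Module ℂ X] : Set (Set X) :=
  {C | ∃ S : Set (X → ℂ), S ⊆ (polyFunctions X : Set (X → ℂ)) ∧ C = {x | ∀ f ∈ S, f x = 0}}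

/-- The Zariski topology on a complex vector space. -/
def zariskiTopology (X : Type) [AddCommGroup X] [Module ℂ X] : TopologicalSpace X :=
  TopologicalSpace.ofClosed (zariskiClosedSets X)
    (by
      refine ⟨{(1 : X → ℂ)}, ?_, ?_⟩
      · intro f hf
        rw [Set.mem_singleton_iff] at hf
        subst hf
        exact (polyFunctions X).one_mem
      · ext x
        constructor
        · exact fun hx => absurd hx (Set.notMem_empty x)
        · intro hx
          have h1 : (1 : X → ℂ) x = 0 := hx 1 rfl
          rw [Pi.one_apply] at h1
          exact absurd h1 one_ne_zero)
    (by
      intro A hA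
      choose S hS1 hS2 using fun C (hC : C ∈ A) => hA hC
      refine ⟨⋃ (C : Set X) (hC : C ∈ A), S C hC, ?_, ?_⟩
      · intro f hf
        simp only [Set.mem_iUnion] at hf
        obtain ⟨C, hC, hfC⟩ := hf
        exact hS1 C hC hfC
      · ext x
        simp only [Set.mem_sInter, Set.mem_setOf_eq, Set.mem_iUnion]
        constructor
        · rintro h f ⟨C, hC, hfC⟩
          have := h C hC
          rw [hS2 C hC] at this
          exact this f hfC
        · intro h C hC
          rw [hS2 C hC]
          exact fun f hf => h f ⟨C, hC, hf⟩)
    (by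
      intro A hA B hB
      obtain ⟨SA, hSA1, hSA2⟩ := hA
      obtain ⟨SB, hSB1, hSB2⟩ := hB
      refine ⟨{h | ∃ f ∈ SA, ∃ g ∈ SB, h = f * g}, ?_, ?_⟩
      · rintro h ⟨f, hf, g, hg, rfl⟩
        exact (polyFunctions X).mul_mem (hSA1 hf) (hSB1 hg)
      · ext x
        simp only [Set.mem_union, Set.mem_setOf_eq]
        constructor
        · rintro (hx | hx) h ⟨f, hf, g, hg, rfl⟩
          · rw [hSA2] at hx
            simp only [Pi.mul_apply, hx f hf, zero_mul]
          · rw [hSB2] at hx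
            simp only [Pi.mul_apply, hx g hg, mul_zero]
        · intro h
          by_contra hc
          push_neg at hc
          obtain ⟨hxA, hxB⟩ := hc
          rw [hSA2] at hxA
          rw [hSB2] at hxB
          simp only [Set.mem_setOf_eq, not_forall] at hxA hxB
          obtain ⟨f, hf, hfx⟩ := hxA
          obtain ⟨g, hg, hgx⟩ := hxB
          have := h (f * g) ⟨f, hf, g, hg, rfl⟩
          rw [Pi.mul_apply] at this
          exact mul_ne_zero hfx hgx this)


open Finset in
/-- Projections attached to an internal direct sum decomposition indexed by bidegrees. -/
lemma exists_proj {X : Type} [AddCommGroup X] [Module ℂ X] (n : ℕ)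
    (V : ℕ → ℕ → Submodule ℂ X) (h0 : ∀ p q, p + q ≠ n → V p q = ⊥)
    (hsup : ⨆ p, ⨆ q, V p q = ⊤)
    (hind : iSupIndep fun pq : ℕ × ℕ => V pq.1 pq.2) :
    ∃ π : ℕ × ℕ → X →ₗ[ℂ] X, (∀ i x, π i x ∈ V i.1 i.2) ∧
      (∀ i, ∀ x ∈ V i.1 i.2, π i x = x) ∧
      (∀ i j, i ≠ j → ∀ x ∈ V j.1 j.2, π i x = 0) ∧
      (∀ x, ∑ i ∈ antidiagonal n, π i x = x) := by
  classical
  have hInternal : DirectSum.IsInternal fun pq : ℕ × ℕ => V pq.1 pq.2 :=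
    DirectSum.isInternal_submodule_of_iSupIndep_of_iSup_eq_top hind (by
      rw [iSup_prod]; exact hsup)
  let V' : ℕ × ℕ → Submodule ℂ X := fun pq => V pq.1 pq.2
  let e : DirectSum (ℕ × ℕ) (fun i => V' i) ≃ₗ[ℂ] X :=
    LinearEquiv.ofBijective (DirectSum.coeLinearMap V') hInternal
  have he : ∀ i, ∀ x (hx : x ∈ V' i), e.symm x = DirectSum.lof ℂ _ (fun i => V' i) i ⟨x, hx⟩ := by
    intro i x hx
    rw [LinearEquiv.symm_apply_eq]
    simp only [e]
    exact (DirectSum.coeLinearMap_lof V' i ⟨x, hx⟩).symm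
  let π : ℕ × ℕ → X →ₗ[ℂ] X := fun i =>
    (V' i).subtype ∘ₗ DirectSum.component ℂ _ (fun i => V' i) i ∘ₗ e.symm.toLinearMap
  have h1 : ∀ i x, π i x ∈ V i.1 i.2 := fun i x =>
    (DirectSum.component ℂ _ (fun i => V' i) i (e.symm x)).2
  have h2 : ∀ i, ∀ x ∈ V i.1 i.2, π i x = x := by
    intro i x hx
    simp only [π, LinearMap.comp_apply, LinearEquiv.coe_coe, he i x hx]
    rw [DirectSum.component.lof_self]; rfl
  have h3 : ∀ i j, i ≠ j → ∀ x ∈ V j.1 j.2, π i x = 0 := by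
    intro i j hij x hx
    simp only [π, LinearMap.comp_apply, LinearEquiv.coe_coe, he j x hx]
    rw [DirectSum.component.of, dif_neg hij.symm]; rfl
  refine ⟨π, h1, h2, h3, ?_⟩
  intro x
  have hx : x ∈ ⨆ pq : ℕ × ℕ, V pq.1 pq.2 := by
    rw [iSup_prod, hsup]; trivial
  induction hx using Submodule.iSup_induction' with
  | mem j x hx =>
    by_cases hj : j.1 + j.2 = n
    · rw [Finset.sum_eq_single j]
      · exact h2 j x hx
      · intro b _ hb; exact h3 b j hb x hx
      · intro h; exact absurd (by simpa using hj) h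
    · rw [h0 _ _ hj, Submodule.mem_bot] at hx
      simp [hx]
  | zero => simp
  | add x y _ _ hx hy => simp only [map_add, Finset.sum_add_distrib, hx, hy]

lemma zariski_closed_iff {X : Type} [AddCommGroup X] [Module ℂ X] (C : Set X) :
    @IsClosed X (zariskiTopology X) C ↔ C ∈ zariskiClosedSets X := by
  rw [← @isOpen_compl_iff X C (zariskiTopology X)]
  change Cᶜᶜ ∈ zariskiClosedSets X ↔ _
  rw [compl_compl]

lemma poly_comp {X : Type} [AddCommGroup X] [Module ℂ X] (g : X →ₗ[ℂ] X) (f : X → ℂ)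
    (hf : f ∈ polyFunctions X) : f ∘ g ∈ polyFunctions X := by
  induction hf using Algebra.adjoin_induction with
  | mem f hf =>
    obtain ⟨l, rfl⟩ := hf
    exact Algebra.subset_adjoin ⟨l ∘ₗ g, rfl⟩
  | algebraMap r => exact (polyFunctions X).algebraMap_mem r
  | add f f' _ _ h h' => exact (polyFunctions X).add_mem h h'
  | mul f f' _ _ h h' => exact (polyFunctions X).mul_mem h h'

lemma zariski_continuous {X : Type} [AddCommGroup X] [Module ℂ X] (g : X →ₗ[ℂ] X) :
    @Continuous X X (zariskiTopology X) (zariskiTopology X) g := by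
  letI := zariskiTopology X
  rw [continuous_iff_isClosed]
  intro C hC
  rw [zariski_closed_iff] at hC ⊢
  obtain ⟨S, hS, rfl⟩ := hC
  refine ⟨(fun f => f ∘ g) '' S, ?_, ?_⟩
  · rintro _ ⟨f, hf, rfl⟩
    exact poly_comp g f (hS hf)
  · ext x
    simp

/-- A polynomial function restricted to a polynomial curve is polynomial. -/
lemma poly_curve {X : Type} [AddCommGroup X] [Module ℂ X] (s : Finset (ℕ × ℕ))
    (v : ℕ × ℕ → X) (f : X → ℂ) (hf : f ∈ polyFunctions X) :
    ∃ P : Polynomial ℂ, ∀ c : ℂ, f (∑ i ∈ s, c ^ i.1 • v i) = P.eval c := by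
  induction hf using Algebra.adjoin_induction with
  | mem f hf =>
    obtain ⟨l, rfl⟩ := hf
    refine ⟨∑ i ∈ s, Polynomial.C (l (v i)) * Polynomial.X ^ i.1, fun c => ?_⟩
    rw [map_sum, Polynomial.eval_finsetSum]
    refine Finset.sum_congr rfl fun i _ => ?_
    simp only [map_smul, smul_eq_mul, Polynomial.eval_mul, Polynomial.eval_C,
      Polynomial.eval_pow, Polynomial.eval_X]
    exact mul_comm _ _
  | algebraMap r => exact ⟨Polynomial.C r, fun c => by simp⟩
  | add f f' _ _ h h' =>
    obtain ⟨P, hP⟩ := h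
    obtain ⟨P', hP'⟩ := h'
    exact ⟨P + P', fun c => by simp [hP, hP']⟩
  | mul f f' _ _ h h' =>
    obtain ⟨P, hP⟩ := h
    obtain ⟨P', hP'⟩ := h'
    exact ⟨P * P', fun c => by simp [hP, hP']⟩

/-- If a polynomial curve meets a Zariski open set, it lies in it outside a finite set of
parameters. -/
lemma curve_open {X : Type} [AddCommGroup X] [Module ℂ X] (s : Finset (ℕ × ℕ))
    (v : ℕ × ℕ → X) (U : Set X) (hU : @IsOpen X (zariskiTopology X) U) (c₀ : ℂ)
    (h : (∑ i ∈ s, c₀ ^ i.1 • v i) ∈ U) :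
    ∃ P : Polynomial ℂ, P ≠ 0 ∧ ∀ c : ℂ, P.eval c ≠ 0 → (∑ i ∈ s, c ^ i.1 • v i) ∈ U := by
  obtain ⟨S, hS, hC⟩ : Uᶜ ∈ zariskiClosedSets X := hU
  have hmem : ∀ x, x ∈ U ↔ ∃ f ∈ S, f x ≠ 0 := by
    intro x
    have : x ∈ Uᶜ ↔ ∀ f ∈ S, f x = 0 := by rw [hC]; rfl
    rw [← not_iff_not, ← Set.mem_compl_iff, this]
    push Not; rfl
  obtain ⟨f, hf, hne⟩ := (hmem _).1 h
  obtain ⟨P, hP⟩ := poly_curve s v f (hS hf)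
  refine ⟨P, ?_, fun c hc => (hmem _).2 ⟨f, hf, by rwa [hP]⟩⟩
  rintro rfl
  rw [hP] at hne
  simp at hne

/-- Sweeping an irreducible set by the one-parameter family of linear maps. -/
lemma sweep_irreducible {X : Type} [AddCommGroup X] [Module ℂ X] (s : Finset (ℕ × ℕ))
    (π : ℕ × ℕ → X →ₗ[ℂ] X) (T : Set X) (hT : @IsIrreducible X (zariskiTopology X) T) :
    @IsIrreducible X (zariskiTopology X)
      {y | ∃ c : ℂ, ∃ t ∈ T, y = ∑ i ∈ s, c ^ i.1 • π i t} := by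
  letI := zariskiTopology X
  obtain ⟨⟨t₀, ht₀⟩, hpre⟩ := hT
  refine ⟨⟨_, 1, t₀, ht₀, rfl⟩, ?_⟩
  rintro U₁ U₂ hU₁ hU₂ ⟨_, ⟨c₁, t₁, ht₁, rfl⟩, hm₁⟩ ⟨_, ⟨c₂, t₂, ht₂, rfl⟩, hm₂⟩
  obtain ⟨P₁, hP₁, h₁⟩ := curve_open s (fun i => π i t₁) U₁ hU₁ c₁ hm₁
  obtain ⟨P₂, hP₂, h₂⟩ := curve_open s (fun i => π i t₂) U₂ hU₂ c₂ hm₂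
  obtain ⟨c, hc⟩ : ∃ c, (P₁ * P₂).eval c ≠ 0 := by
    by_contra! hcon
    exact mul_ne_zero hP₁ hP₂ (Polynomial.funext fun c => by simpa using hcon c)
  rw [Polynomial.eval_mul] at hc
  let g : X →ₗ[ℂ] X := ∑ i ∈ s, c ^ i.1 • π i
  have hg : ∀ t, g t = ∑ i ∈ s, c ^ i.1 • π i t := fun t => by
    simp [g, LinearMap.sum_apply]
  have hcont : Continuous g := zariski_continuous g
  obtain ⟨t, ht, htU₁, htU₂⟩ := hpre (g ⁻¹' U₁) (g ⁻¹' U₂) (hU₁.preimage hcont)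
    (hU₂.preimage hcont)
    ⟨t₁, ht₁, by
      rw [Set.mem_preimage, hg]; exact h₁ c (left_ne_zero_of_mul hc)⟩
    ⟨t₂, ht₂, by
      rw [Set.mem_preimage, hg]; exact h₂ c (right_ne_zero_of_mul hc)⟩
  exact ⟨g t, ⟨c, t, ht, hg t⟩, htU₁, htU₂⟩

/-- **Deligne's Lemma, for the quadratic locus.** Let `B`, `B'` be
finite-dimensional `ℚ`-vector spaces whose complexifications carry Hodge decompositions of
weights `k` and `2k` (compatible with conjugation), and let `m : B × B → B'` be a `ℚ`-bilinear
map whose complexification `m_ℂ` is a morphism of Hodge structures. Let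
`Z = {α ∈ B_ℂ : m_ℂ(α,α) = 0}` and let `Z₁ ⊆ Z` be a union of irreducible components of `Z` in
the Zariski topology of `B_ℂ`. If the `ℂ`-linear span of `Z₁` equals `ℂ ⊗ Q` for a `ℚ`-subspace
`Q ⊆ B`, then `Q` is a rational sub-Hodge structure of `B`: `ℂ ⊗ Q` is the direct sum over
`p + q = k` of its intersections with the components `B^{p,q}`. -/
theorem deligne_lemma_quadratic_locus
    (k : ℕ) (hk : 1 ≤ k)
    (B : Type) [AddCommGroup B] [Module ℚ B] [FiniteDimensional ℚ B]
    (B' : Type) [AddCommGroup B'] [Module ℚ B'] [FiniteDimensional ℚ B']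
    (Bpq : ℕ → ℕ → Submodule ℂ (ℂ ⊗[ℚ] B))
    (B'pq : ℕ → ℕ → Submodule ℂ (ℂ ⊗[ℚ] B'))
    (hBzero : ∀ p q, p + q ≠ k → Bpq p q = ⊥)
    (hB'zero : ∀ p q, p + q ≠ 2 * k → B'pq p q = ⊥)
    (hBsup : ⨆ p, ⨆ q, Bpq p q = ⊤)
    (hB'sup : ⨆ p, ⨆ q, B'pq p q = ⊤)
    (hBindep : iSupIndep fun pq : ℕ × ℕ => Bpq pq.1 pq.2)
    (hB'indep : iSupIndep fun pq : ℕ × ℕ => B'pq pq.1 pq.2)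
    (hBconj : ∀ p q, Submodule.map (conjV B) ((Bpq p q).restrictScalars ℚ) =
      (Bpq q p).restrictScalars ℚ)
    (hB'conj : ∀ p q, Submodule.map (conjV B') ((B'pq p q).restrictScalars ℚ) =
      (B'pq q p).restrictScalars ℚ)
    (m : B →ₗ[ℚ] B →ₗ[ℚ] B')
    (mC : (ℂ ⊗[ℚ] B) →ₗ[ℂ] (ℂ ⊗[ℚ] B) →ₗ[ℂ] (ℂ ⊗[ℚ] B'))
    (hmC : ∀ (z w : ℂ) (x y : B), mC (z ⊗ₜ[ℚ] x) (w ⊗ₜ[ℚ] y) = (z * w) ⊗ₜ[ℚ] (m x y))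
    (hmorph : ∀ p q r s, ∀ x ∈ Bpq p q, ∀ y ∈ Bpq r s, mC x y ∈ B'pq (p + r) (q + s))
    (Q : Submodule ℚ B) (Z₁ : Set (ℂ ⊗[ℚ] B))
    (hZ₁ : ∃ 𝒯 : Set (Set (ℂ ⊗[ℚ] B)), Z₁ = ⋃₀ 𝒯 ∧
      ∀ T ∈ 𝒯, T ⊆ {α : ℂ ⊗[ℚ] B | mC α α = 0} ∧
        @IsIrreducible _ (zariskiTopology (ℂ ⊗[ℚ] B)) T ∧
        (∀ T' : Set (ℂ ⊗[ℚ] B), T ⊆ T' → T' ⊆ {α : ℂ ⊗[ℚ] B | mC α α = 0} →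
          @IsIrreducible _ (zariskiTopology (ℂ ⊗[ℚ] B)) T' → T' = T))
    (hspan : Submodule.span ℂ Z₁ = Submodule.span ℂ (⇑(iotaV B) '' Q)) :
    Submodule.span ℂ (⇑(iotaV B) '' Q) =
      ⨆ (p : ℕ) (q : ℕ) (_ : p + q = k),
        (Submodule.span ℂ (⇑(iotaV B) '' Q) ⊓ Bpq p q) := by
  classical
  obtain ⟨π, h1, -, -, h4⟩ := exists_proj k Bpq hBzero hBsup hBindep
  obtain ⟨ρ, r1, r2, r3, r4⟩ := exists_proj (2 * k) B'pq hB'zero hB'sup hB'indep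
  have hZ : ∀ (c : ℂ) (x : ℂ ⊗[ℚ] B), mC x x = 0 →
      mC (∑ i ∈ Finset.HasAntidiagonal.antidiagonal k, c ^ i.1 • π i x)
        (∑ i ∈ Finset.HasAntidiagonal.antidiagonal k, c ^ i.1 • π i x) = 0 := by
    intro c x hx
    let g' : (ℂ ⊗[ℚ] B') →ₗ[ℂ] (ℂ ⊗[ℚ] B') :=
      ∑ j ∈ Finset.HasAntidiagonal.antidiagonal (2 * k), c ^ j.1 • ρ j
    have hg' : ∀ j ∈ Finset.HasAntidiagonal.antidiagonal (2 * k), ∀ y ∈ B'pq j.1 j.2, g' y = c ^ j.1 • y := by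
      intro j hj y hy
      simp only [g', LinearMap.sum_apply, LinearMap.smul_apply]
      rw [Finset.sum_eq_single j]
      · rw [r2 j y hy]
      · intro b _ hb
        rw [r3 b j hb y hy, smul_zero]
      · intro h; exact absurd hj h
    have hxx : g' (mC (∑ i ∈ Finset.HasAntidiagonal.antidiagonal k, π i x)
        (∑ i ∈ Finset.HasAntidiagonal.antidiagonal k, π i x)) = 0 := by
      rw [h4, hx, map_zero]
    rw [← hxx]
    simp only [map_sum, LinearMap.sum_apply, map_smul, LinearMap.smul_apply]
    refine Finset.sum_congr rfl fun i hi => ?_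
    try rw [Finset.smul_sum]
    refine Finset.sum_congr rfl fun j hj => ?_
    rw [Finset.HasAntidiagonal.mem_antidiagonal] at hi hj
    rw [hg' (j.1 + i.1, j.2 + i.2) (by rw [Finset.HasAntidiagonal.mem_antidiagonal]; dsimp only; omega) _
      (hmorph _ _ _ _ _ (h1 j x) _ (h1 i x)), smul_smul, pow_add]
    try rw [mul_comm]
  obtain ⟨𝒯, rfl, h𝒯⟩ := hZ₁
  rw [← hspan]
  set W := Submodule.span ℂ (⋃₀ 𝒯) with hW
  have hstab : ∀ (c : ℂ), ∀ x ∈ W, (∑ i ∈ Finset.HasAntidiagonal.antidiagonal k, c ^ i.1 • π i) x ∈ W := by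
    intro c x hx
    have : W ≤ W.comap (∑ i ∈ Finset.HasAntidiagonal.antidiagonal k, c ^ i.1 • π i) := by
      rw [hW, Submodule.span_le]
      rintro t ⟨T, hT, ht⟩
      obtain ⟨hTZ, hirr, hmax⟩ := h𝒯 T hT
      have heq := hmax {y | ∃ c : ℂ, ∃ t ∈ T, y = ∑ i ∈ Finset.HasAntidiagonal.antidiagonal k, c ^ i.1 • π i t}
        (fun t ht => ⟨1, t, ht, by simp [h4]⟩)
        (by
          rintro _ ⟨c, t, ht, rfl⟩
          exact hZ c t (hTZ ht))
        (sweep_irreducible _ π T hirr)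
      refine Submodule.subset_span ⟨T, hT, ?_⟩
      rw [← heq]
      exact ⟨c, t, ht, by simp [LinearMap.sum_apply]⟩
    exact this hx
  have hproj : ∀ x ∈ W, ∀ i ∈ Finset.HasAntidiagonal.antidiagonal k, π i x ∈ W := by
    intro x hx i hi
    by_contra hcon
    obtain ⟨f, hf, hWf⟩ := Submodule.exists_le_ker_of_notMem hcon
    have hP : (∑ j ∈ Finset.HasAntidiagonal.antidiagonal k,
        Polynomial.C (f (π j x)) * Polynomial.X ^ j.1 : Polynomial ℂ) = 0 := by
      refine Polynomial.funext fun c => ?_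
      have := hWf (hstab c x hx)
      rw [LinearMap.mem_ker] at this
      rw [LinearMap.sum_apply, map_sum] at this
      rw [Polynomial.eval_finsetSum, Polynomial.eval_zero, ← this]
      refine Finset.sum_congr rfl fun i _ => ?_
      simp only [LinearMap.smul_apply, map_smul, smul_eq_mul, Polynomial.eval_mul,
        Polynomial.eval_C, Polynomial.eval_pow, Polynomial.eval_X]
      exact mul_comm _ _
    have hco := congrArg (fun P => Polynomial.coeff P i.1) hP
    simp only [Polynomial.finsetSum_coeff, Polynomial.coeff_C_mul_X_pow,
      Polynomial.coeff_zero] at hco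
    rw [Finset.sum_eq_single i] at hco
    · simp at hco; exact hf hco
    · intro j hj hji
      rw [if_neg]
      intro h
      rw [Finset.HasAntidiagonal.mem_antidiagonal] at hi hj
      exact hji (Prod.ext h.symm (by omega))
    · intro h; exact absurd hi h
  apply le_antisymm
  · intro x hx
    rw [← h4 x]
    refine Submodule.sum_mem _ fun i hi => ?_
    have hi' := Finset.HasAntidiagonal.mem_antidiagonal.1 hi
    exact Submodule.mem_iSup_of_mem i.1 (Submodule.mem_iSup_of_mem i.2
      (Submodule.mem_iSup_of_mem hi' ⟨hproj x hx i hi, h1 i x⟩))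
  · exact iSup_le fun p => iSup_le fun q => iSup_le fun _ => inf_le_left

end VoisinPaper
end
end
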